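/- arXiv:1501.02237 — 3 statements merged into one kernel-verified Lean document; each statement's English description precedes it below -/
import Mathlib

section
/- Let A ∈ M_{n×m}(ℤ) with rank r, let P, Q be unimodular with P·A·Q in Smith Normal Form with nonzero diagonal entries d₁, …, d_r, let b ∈ (ℂˣ)^m satisfy the consistency condition b^{Q₀} = (1,…,1), and for each j = 1, …, r fix ζ_j ∈ ℂˣ with ζ_j^{d_j} = (b^Q)_j. For each tuple (k₁, …, k_r) with 0 ≤ k_j ≤ |d_j| − 1, define φ_{k₁,…,k_r} : (ℂˣ)^{n−r} → (ℂˣ)^n by φ_{k₁,…,k_r}(t) = (e^{2πi k₁/d₁} ζ₁, …, e^{2πi k_r/d_r} ζ_r, t₁, …, t_{n−r})^P. Then each φ_{k₁,…,k_r} is injective, the images of distinct tuples (k₁,…,k_r) are pairwise disjoint, and the union of all these images equals the solution set {x ∈ (ℂˣ)^n : x^A = b}. -/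
/-- Matrix exponent: for `x ∈ (ℂˣ)^n` and `A ∈ M_{n×m}(ℤ)`,
`(x^A)_j = ∏_i x_i ^ A_{ij}`. -/
def matExp {n m : ℕ} (x : Fin n → ℂˣ) (A : Matrix (Fin n) (Fin m) ℤ) : Fin m → ℂˣ :=
  fun j => ∏ i, x i ^ A i j

/-- `e^θ` as a unit of `ℂ`. -/
noncomputable def expUnit (θ : ℂ) : ℂˣ :=
  Units.mk0 (Complex.exp θ) (Complex.exp_ne_zero θ)

theorem matExp_mul {n m l : ℕ} (x : Fin n → ℂˣ) (A : Matrix (Fin n) (Fin m) ℤ)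
    (B : Matrix (Fin m) (Fin l) ℤ) : matExp x (A * B) = matExp (matExp x A) B := by
  have hs : ∀ {N : ℕ} (u : ℂˣ) (f : Fin N → ℤ), u ^ (∑ j, f j) = ∏ j, u ^ f j := by
    intro N u f
    induction N with
    | zero => simp
    | succ N ih => rw [Fin.sum_univ_succ, Fin.prod_univ_succ, zpow_add, ih]
  funext j
  simp only [matExp, Matrix.mul_apply]
  simp_rw [← Finset.prod_zpow, hs, zpow_mul]
  exact Finset.prod_comm

theorem matExp_one {n : ℕ} (x : Fin n → ℂˣ) :
    matExp x (1 : Matrix (Fin n) (Fin n) ℤ) = x := by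
  funext j
  simp only [matExp]
  rw [Finset.prod_eq_single j]
  · simp
  · intro i _ h
    simp [Matrix.one_apply_ne h]
  · simp

theorem matExp_inv {n : ℕ} (P : Matrix (Fin n) (Fin n) ℤ) (hP : P.det = 1 ∨ P.det = -1) :
    ∃ P' : Matrix (Fin n) (Fin n) ℤ, (∀ x, matExp (matExp x P) P' = x) ∧
      (∀ x, matExp (matExp x P') P = x) := by
  have hu : IsUnit P.det := Int.isUnit_iff.2 hP
  refine ⟨P⁻¹, fun x => ?_, fun x => ?_⟩
  · rw [← matExp_mul, Matrix.mul_nonsing_inv _ hu, matExp_one]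
  · rw [← matExp_mul, Matrix.nonsing_inv_mul _ hu, matExp_one]

theorem expUnit_pow (d : ℤ) (hd : d ≠ 0) (k : ℕ) :
    (expUnit (2 * (Real.pi : ℂ) * Complex.I * (k : ℂ) / (d : ℂ))) ^ d = 1 := by
  have hd' : (d : ℂ) ≠ 0 := by exact_mod_cast hd
  ext
  simp only [expUnit, Units.val_zpow_eq_zpow_val, Units.val_mk0, Units.val_one]
  rw [← Complex.exp_int_mul, Complex.exp_eq_one_iff]
  refine ⟨k, ?_⟩
  push_cast
  field_simp

theorem expUnit_inj (d : ℤ) (hd : d ≠ 0) (k k' : ℕ) (hk : k < d.natAbs) (hk' : k' < d.natAbs)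
    (h : expUnit (2 * (Real.pi : ℂ) * Complex.I * (k : ℂ) / (d : ℂ)) =
      expUnit (2 * (Real.pi : ℂ) * Complex.I * (k' : ℂ) / (d : ℂ))) : k = k' := by
  have hd' : (d : ℂ) ≠ 0 := by exact_mod_cast hd
  have h1 := congrArg Units.val h
  simp only [expUnit, Units.val_mk0] at h1
  obtain ⟨N, hN⟩ := Complex.exp_eq_exp_iff_exists_int.1 h1
  have hpi := Complex.two_pi_I_ne_zero
  have h2 : (2 * (Real.pi : ℂ) * Complex.I) * (k : ℂ) =
      (2 * (Real.pi : ℂ) * Complex.I) * ((k' : ℂ) + N * d) := by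
    rw [div_eq_iff hd'] at hN
    rw [hN]
    field_simp
  have h3 : (k : ℤ) = k' + N * d := by exact_mod_cast mul_left_cancel₀ hpi h2
  have h4 : d ∣ (k : ℤ) - k' := ⟨N, by rw [h3]; ring⟩
  have h5 : (k : ℤ) - k' = 0 := by
    apply Int.eq_zero_of_abs_lt_dvd ((abs_dvd d _).2 h4)
    rw [abs_lt, Int.abs_eq_natAbs]
    constructor <;> omega
  omega

theorem expUnit_surj (d : ℤ) (hd : d ≠ 0) (u : ℂˣ) (hu : u ^ d = 1) :
    ∃ k : ℕ, k < d.natAbs ∧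
      u = expUnit (2 * (Real.pi : ℂ) * Complex.I * (k : ℂ) / (d : ℂ)) := by
  have hd' : (d : ℂ) ≠ 0 := by exact_mod_cast hd
  have h1 := congrArg Units.val hu
  simp only [Units.val_zpow_eq_zpow_val, Units.val_one] at h1
  rw [← Complex.exp_log u.ne_zero, ← Complex.exp_int_mul, Complex.exp_eq_one_iff] at h1
  obtain ⟨N, hN⟩ := h1
  have hk0 := Int.emod_nonneg N hd
  have hk1 := Int.emod_lt_abs N hd
  refine ⟨(N % d).toNat, by rw [Int.abs_eq_natAbs] at hk1; omega, ?_⟩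
  ext
  simp only [expUnit, Units.val_mk0]
  conv_lhs => rw [← Complex.exp_log u.ne_zero]
  rw [Complex.exp_eq_exp_iff_exists_int]
  refine ⟨N / d, ?_⟩
  have h2 : (((N % d).toNat : ℕ) : ℂ) = ((N % d : ℤ) : ℂ) := by
    rw [← Int.cast_natCast, Int.toNat_of_nonneg hk0]
  have h3 : (N : ℂ) = ((N % d : ℤ) : ℂ) + d * ((N / d : ℤ) : ℂ) := by
    exact_mod_cast (Int.emod_add_mul_ediv N d).symm
  rw [h2]
  apply mul_left_cancel₀ hd'
  rw [hN, h3]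
  field_simp

theorem stmt9 {n m : ℕ} (A : Matrix (Fin n) (Fin m) ℤ) (r : ℕ)
    (hr : r = (A.map (Int.cast : ℤ → ℚ)).rank)
    (P : Matrix (Fin n) (Fin n) ℤ) (Q : Matrix (Fin m) (Fin m) ℤ)
    (hP : P.det = 1 ∨ P.det = -1) (hQ : Q.det = 1 ∨ Q.det = -1)
    (d : Fin r → ℤ) (hd : ∀ i, d i ≠ 0)
    (hSNF : ∀ (i : Fin n) (j : Fin m),
      (P * A * Q) i j =
        if h : (i : ℕ) = (j : ℕ) ∧ (i : ℕ) < r then d ⟨(i : ℕ), h.2⟩ else 0)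
    (b : Fin m → ℂˣ)
    (hcons : matExp b (Matrix.of fun (i : Fin m) (j : Fin (m - r)) =>
      Q i ⟨r + (j : ℕ), by have := j.isLt; omega⟩) = fun _ => 1)
    (ζ : Fin r → ℂˣ) (hζ : ∀ j, ζ j ^ d j = matExp b Q ⟨(j : ℕ), by
      have h1 := j.isLt
      have h2 := Matrix.rank_le_card_width (A.map (Int.cast : ℤ → ℚ))
      simp only [Fintype.card_fin] at h2
      omega⟩) :
    let φ : (Fin r → ℕ) → (Fin (n - r) → ℂˣ) → (Fin n → ℂˣ) := fun k t =>
      matExp (fun i : Fin n =>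
        if h : (i : ℕ) < r then
          expUnit (2 * (Real.pi : ℂ) * Complex.I *
              ((k ⟨(i : ℕ), h⟩ : ℕ) : ℂ) / ((d ⟨(i : ℕ), h⟩ : ℤ) : ℂ)) * ζ ⟨(i : ℕ), h⟩
        else t ⟨(i : ℕ) - r, by have := i.isLt; omega⟩) P
    (∀ k : Fin r → ℕ, (∀ j, k j < (d j).natAbs) → Function.Injective (φ k)) ∧
    (∀ k k' : Fin r → ℕ, (∀ j, k j < (d j).natAbs) → (∀ j, k' j < (d j).natAbs) →
      k ≠ k' → Set.range (φ k) ∩ Set.range (φ k') = ∅) ∧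
    (⋃ k ∈ {k : Fin r → ℕ | ∀ j, k j < (d j).natAbs}, Set.range (φ k)) =
      {x : Fin n → ℂˣ | matExp x A = b} := by
  intro φ
  obtain ⟨P', hP1, hP2⟩ := matExp_inv P hP
  obtain ⟨Q', hQ1, _⟩ := matExp_inv Q hQ
  have hrm : r ≤ m := by
    have h2 := Matrix.rank_le_card_width (A.map (Int.cast : ℤ → ℚ))
    simp only [Fintype.card_fin] at h2
    omega
  have hrn : r ≤ n := by
    have h2 := Matrix.rank_le_card_height (A.map (Int.cast : ℤ → ℚ))
    simp only [Fintype.card_fin] at h2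
    omega
  have Pinj : ∀ x y, matExp x P = matExp y P → x = y := fun x y h => by
    rw [← hP1 x, h, hP1]
  -- the coordinates determined by an equality of parametrised points
  have key : ∀ k k' t t', φ k t = φ k' t' →
      (∀ j : Fin r, expUnit (2 * (Real.pi : ℂ) * Complex.I * (k j : ℂ) / (d j : ℂ)) =
        expUnit (2 * (Real.pi : ℂ) * Complex.I * (k' j : ℂ) / (d j : ℂ))) ∧ t = t' := by
    intro k k' t t' h
    have h1 := Pinj _ _ h
    constructor
    · intro j
      have h2 := congrFun h1 ⟨j, by omega⟩
      simpa using h2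
    · funext j
      have h2 := congrFun h1 ⟨r + j, by omega⟩
      simpa using h2
  -- solutions in the `y` coordinates
  have sol : ∀ y : Fin n → ℂˣ, matExp (matExp y P) A = b ↔
      ∀ j : Fin r, y ⟨j, by omega⟩ ^ d j = ζ j ^ d j := by
    intro y
    have e1 : matExp (matExp y P) A = b ↔ matExp y (P * A * Q) = matExp b Q := by
      rw [matExp_mul, matExp_mul]
      constructor
      · intro h
        rw [h]
      · intro h
        rw [← hQ1 b, ← h, hQ1]
    have lo : ∀ j : Fin r, matExp y (P * A * Q) ⟨j, by omega⟩ = y ⟨j, by omega⟩ ^ d j := by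
      intro j
      unfold matExp
      rw [Finset.prod_eq_single (⟨j, by omega⟩ : Fin n)]
      · rw [hSNF]
        simp
      · intro i _ hi
        rw [hSNF, dif_neg]
        · simp
        · rintro ⟨h, _⟩
          exact hi (Fin.ext h)
      · simp
    have hi : ∀ j : Fin m, r ≤ (j : ℕ) → matExp y (P * A * Q) j = 1 := by
      intro j hj
      unfold matExp
      apply Finset.prod_eq_one
      intro i _
      rw [hSNF, dif_neg]
      · simp
      · rintro ⟨h, h'⟩
        omega
    have hib : ∀ j : Fin m, r ≤ (j : ℕ) → matExp b Q j = 1 := by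
      intro j hj
      have h := congrFun hcons ⟨j - r, by omega⟩
      have hj' : (⟨r + (j - r), by omega⟩ : Fin m) = j := Fin.ext (by simp; omega)
      simpa [matExp, hj'] using h
    rw [e1]
    constructor
    · intro h j
      rw [hζ j, ← h, lo]
    · intro h
      funext j
      by_cases hj : (j : ℕ) < r
      · have := lo ⟨j, hj⟩
        rw [h, hζ] at this
        exact this
      · rw [hi j (by omega), hib j (by omega)]
  refine ⟨?_, ?_, ?_⟩
  · intro k _ t t' h
    exact (key _ _ _ _ h).2
  · intro k k' hk hk' hne
    rw [Set.eq_empty_iff_forall_notMem]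
    rintro x ⟨⟨t, ht⟩, ⟨t', ht'⟩⟩
    apply hne
    funext j
    exact expUnit_inj (d j) (hd j) _ _ (hk j) (hk' j) ((key _ _ _ _ (ht.trans ht'.symm)).1 j)
  · ext x
    simp only [Set.mem_iUnion, Set.mem_ofPred_eq, Set.mem_range, exists_prop]
    constructor
    · rintro ⟨k, hk, t, rfl⟩
      refine (sol _).2 fun j => ?_
      simp [mul_zpow, expUnit_pow _ (hd j)]
    · intro hx
      have hx' : matExp (matExp (matExp x P') P) A = b := by rw [hP2, hx]
      have h := (sol _).1 hx'
      have h1 : ∀ j : Fin r, ∃ k : ℕ, k < (d j).natAbs ∧ matExp x P' ⟨j, by omega⟩ / ζ j =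
          expUnit (2 * (Real.pi : ℂ) * Complex.I * (k : ℂ) / (d j : ℂ)) := fun j =>
        expUnit_surj (d j) (hd j) _ (by rw [div_zpow, h, div_self'])
      choose k hk hk2 using h1
      refine ⟨k, hk, fun j => matExp x P' ⟨r + j, by omega⟩, ?_⟩
      conv_rhs => rw [← hP2 x]
      refine congrArg (fun y => matExp y P) ?_
      funext i
      by_cases hi : (i : ℕ) < r
      · simp only [dif_pos hi]
        rw [← hk2]
        simp
      · simp only [dif_neg hi]
        congr 1
        exact Fin.ext (by simp; omega)
end

section
/- In the setting of the global parametrization (A ∈ M_{n×m}(ℤ) of rank r, Smith Normal Form P·A·Q with diagonal entries d₁,…,d_r, consistency condition b^{Q₀} = (1,…,1), fixed roots ζ_j with ζ_j^{d_j} = (b^Q)_j), each map φ_{k₁,…,k_r} : (ℂˣ)^{n−r} → (ℂˣ)^n, φ_{k₁,…,k_r}(t) = (e^{2πi k₁/d₁} ζ₁, …, e^{2πi k_r/d_r} ζ_r, t)^P, is a topological embedding (a homeomorphism onto its image), and its image is a connected component of the solution set {x ∈ (ℂˣ)^n : x^A = b}. In particular every connected component of the solution set is homeomorphic to (ℂˣ)^{n−r}.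 -/
/-- The matrix exponent `x^M`. -/
noncomputable def mexp {p q : ℕ} (M : Matrix (Fin p) (Fin q) ℤ) (x : Fin p → ℂ) : Fin q → ℂ :=
  fun j => ∏ i, x i ^ M i j

theorem mexp_ne_zero {p q : ℕ} (M : Matrix (Fin p) (Fin q) ℤ) (x : Fin p → ℂ)
    (hx : ∀ i, x i ≠ 0) (j : Fin q) : mexp M x j ≠ 0 :=
  Finset.prod_ne_zero_iff.2 fun i _ => zpow_ne_zero _ (hx i)

theorem zpow_sum_aux {ι : Type*} (s : Finset ι) (a : ℂ) (ha : a ≠ 0) (f : ι → ℤ) :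
    a ^ (∑ i ∈ s, f i) = ∏ i ∈ s, a ^ f i := by
  classical
  induction s using Finset.induction_on with
  | empty => simp
  | insert i s hi ih => rw [Finset.sum_insert hi, Finset.prod_insert hi, zpow_add₀ ha, ih]

theorem mexp_mul {p q s : ℕ} (M : Matrix (Fin p) (Fin q) ℤ) (N : Matrix (Fin q) (Fin s) ℤ)
    (x : Fin p → ℂ) (hx : ∀ i, x i ≠ 0) : mexp (M * N) x = mexp N (mexp M x) := by
  funext j
  simp only [mexp, Matrix.mul_apply]
  have h1 : ∀ i, x i ^ (∑ l, M i l * N l j) = ∏ l, (x i ^ M i l) ^ N l j := by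
    intro i
    rw [zpow_sum_aux _ _ (hx i)]
    exact Finset.prod_congr rfl fun l _ => zpow_mul _ _ _
  simp only [h1]
  rw [Finset.prod_comm]
  exact Finset.prod_congr rfl fun l _ => Finset.prod_zpow _ _ _

theorem mexp_one {p : ℕ} (x : Fin p → ℂ) : mexp (1 : Matrix (Fin p) (Fin p) ℤ) x = x := by
  funext j
  simp only [mexp]
  rw [Finset.prod_eq_single j]
  · simp
  · intro i _ hij
    simp [Matrix.one_apply_ne hij]
  · simp

theorem mexp_continuousOn {p q : ℕ} (M : Matrix (Fin p) (Fin q) ℤ) :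
    ContinuousOn (mexp M) {x | ∀ i, x i ≠ 0} := by
  refine continuousOn_pi.2 fun j => ?_
  refine continuousOn_finsetProd _ fun i _ => ?_
  exact ContinuousOn.zpow₀ (continuous_apply i).continuousOn _ (fun x hx => Or.inl (hx i))

/-- Put `c` in front of `t`. -/
def glue {n r : ℕ} (c : Fin r → ℂ) (t : Fin (n - r) → ℂ) : Fin n → ℂ := fun i =>
  if h : (i : ℕ) < r then c ⟨i, h⟩ else t ⟨(i : ℕ) - r, by have := i.isLt; omega⟩

theorem glue_ne_zero {n r : ℕ} (c : Fin r → ℂ) (t : Fin (n - r) → ℂ)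
    (hc : ∀ i, c i ≠ 0) (ht : ∀ i, t i ≠ 0) (i : Fin n) : glue c t i ≠ 0 := by
  unfold glue
  split_ifs
  · exact hc _
  · exact ht _

theorem glue_continuous {n r : ℕ} (c : Fin r → ℂ) :
    Continuous (fun t : Fin (n - r) → ℂ => (glue c t : Fin n → ℂ)) := by
  refine continuous_pi fun i => ?_
  unfold glue
  split_ifs
  · exact continuous_const
  · exact continuous_apply _

/-- The last coordinates. -/
def tailv {n r : ℕ} (y : Fin n → ℂ) : Fin (n - r) → ℂ := fun i =>
  y ⟨r + i, by have := i.isLt; omega⟩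

theorem tailv_glue {n r : ℕ} (c : Fin r → ℂ) (t : Fin (n - r) → ℂ) :
    tailv (glue c t : Fin n → ℂ) = t := by
  funext i
  simp [tailv, glue]

theorem glue_tailv {n r : ℕ} (hrn : r ≤ n) (y : Fin n → ℂ) :
    glue (fun i : Fin r => y (Fin.castLE hrn i)) (tailv y) = y := by
  funext i
  unfold glue tailv
  split_ifs with h
  · rfl
  · congr 1
    ext
    simp
    omega

theorem glue_head {n r : ℕ} (hrn : r ≤ n) (c : Fin r → ℂ) (t : Fin (n - r) → ℂ) (i : Fin r) :
    (glue c t : Fin n → ℂ) (Fin.castLE hrn i) = c i := by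
  simp [glue]

theorem finite_zpow_roots (d : ℤ) (hd : d ≠ 0) (a : ℂ) : {z : ℂ | z ^ d = a}.Finite := by
  have key : ∀ (k : ℕ), k ≠ 0 → ∀ a : ℂ, {z : ℂ | z ^ k = a}.Finite := by
    intro k hk a
    refine (Polynomial.nthRoots k a).toFinset.finite_toSet.subset fun z hz => ?_
    simp only [Finset.mem_coe, Multiset.mem_toFinset]
    exact (Polynomial.mem_nthRoots (Nat.pos_of_ne_zero hk)).2 hz
  obtain ⟨k, rfl | rfl⟩ := d.eq_nat_or_neg
  · simpa using key k (by simpa using hd) a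
  · refine (key k (by simpa using hd) a⁻¹).subset fun z hz => ?_
    simp only [Set.mem_setOf_eq, zpow_neg, zpow_natCast] at hz ⊢
    rw [← hz, inv_inv]

theorem core {n r : ℕ} (hrn : r ≤ n) (P P' : Matrix (Fin n) (Fin n) ℤ)
    (h1 : P * P' = 1) (h2 : P' * P = 1) (d : Fin r → ℤ) (hd : ∀ i, d i ≠ 0)
    (a : Fin r → ℂ) (V : Set (Fin n → ℂ))
    (hV : ∀ x, x ∈ V ↔ (∀ i, x i ≠ 0) ∧ ∀ i : Fin r, (mexp P' x (Fin.castLE hrn i)) ^ d i = a i)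
    (c : Fin r → ℂ) (hc0 : ∀ i, c i ≠ 0) (hc : ∀ i, c i ^ d i = a i)
    (φ : {t : Fin (n - r) → ℂ // ∀ i, t i ≠ 0} → (Fin n → ℂ))
    (hφ : ∀ t, φ t = mexp P (glue c t.1)) :
    Topology.IsEmbedding φ ∧ Set.range φ ⊆ V ∧
        ∀ x ∈ Set.range φ, connectedComponentIn V x = Set.range φ := by
  have hinv : ∀ t, mexp P' (φ t) = glue c t.1 := fun t => by
    rw [hφ, ← mexp_mul _ _ _ (glue_ne_zero c t.1 hc0 t.2), h1, mexp_one]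
  have hne : ∀ t i, φ t i ≠ 0 := fun t i => by
    rw [hφ]; exact mexp_ne_zero _ _ (glue_ne_zero c t.1 hc0 t.2) i
  have hcont : Continuous φ := by
    have : φ = fun t => mexp P (glue c t.1) := funext hφ
    rw [this]
    exact (mexp_continuousOn P).comp_continuous
      ((glue_continuous c).comp continuous_subtype_val)
      (fun t => glue_ne_zero c t.1 hc0 t.2)
  have hsub : Set.range φ ⊆ V := by
    rintro _ ⟨t, rfl⟩
    refine (hV _).2 ⟨hne t, fun i => ?_⟩
    rw [hinv, glue_head, hc]
  refine ⟨?_, hsub, ?_⟩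
  · let ψ : {t : Fin (n - r) → ℂ // ∀ i, t i ≠ 0} → {x : Fin n → ℂ // ∀ i, x i ≠ 0} :=
      fun t => ⟨φ t, hne t⟩
    let g : {x : Fin n → ℂ // ∀ i, x i ≠ 0} → {t : Fin (n - r) → ℂ // ∀ i, t i ≠ 0} :=
      fun x => ⟨tailv (mexp P' x.1), fun i => mexp_ne_zero _ _ x.2 _⟩
    have hψ : Continuous ψ := hcont.subtype_mk _
    have hg : Continuous g := by
      refine Continuous.subtype_mk ?_ _
      have h3 : Continuous fun x : {x : Fin n → ℂ // ∀ i, x i ≠ 0} => mexp P' x.1 :=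
        (mexp_continuousOn P').comp_continuous continuous_subtype_val (fun x => x.2)
      exact continuous_pi fun i => (continuous_apply _).comp h3
    have hgψ : Function.LeftInverse g ψ := fun t => by
      apply Subtype.ext
      change tailv (mexp P' (φ t)) = t.1
      rw [hinv, tailv_glue]
    exact Topology.IsEmbedding.subtypeVal.comp (hgψ.isEmbedding hg hψ)
  · rintro x ⟨t, rfl⟩
    have hX : IsPreconnected (Set.range φ) := by
      have h3 : IsPreconnected {t : Fin (n - r) → ℂ | ∀ i, t i ≠ 0} := by
        have h4 : IsPreconnected (Set.univ.pi fun _ : Fin (n - r) => ({0}ᶜ : Set ℂ)) := by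
          refine isPreconnected_univ_pi fun i => ?_
          exact (isConnected_compl_singleton_of_one_lt_rank (by simp) 0).isPreconnected
        convert h4 using 1
        ext t; simp
      haveI : PreconnectedSpace {t : Fin (n - r) → ℂ // ∀ i, t i ≠ 0} :=
        Subtype.preconnectedSpace h3
      exact isPreconnected_range hcont
    refine Set.Subset.antisymm ?_ (hX.subset_connectedComponentIn ⟨t, rfl⟩ hsub)
    intro x' hx'
    have hmem : φ t ∈ V := hsub ⟨t, rfl⟩
    have hC := isPreconnected_connectedComponentIn (F := V) (x := φ t)
    have hCV := connectedComponentIn_subset V (φ t)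
    have hx'V := (hV _).1 (hCV hx')
    have hhead : ∀ i : Fin r, mexp P' x' (Fin.castLE hrn i) = c i := by
      intro i
      have hcI : ContinuousOn (fun x => mexp P' x (Fin.castLE hrn i))
          (connectedComponentIn V (φ t)) :=
        (continuous_apply _).comp_continuousOn
          ((mexp_continuousOn P').mono fun y hy => ((hV _).1 (hCV hy)).1)
      have him := hC.image _ hcI
      have hfin : ((fun x => mexp P' x (Fin.castLE hrn i)) ''
          (connectedComponentIn V (φ t))).Finite := by
        refine (finite_zpow_roots (d i) (hd i) (a i)).subset ?_
        rintro _ ⟨y, hy, rfl⟩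
        exact ((hV _).1 (hCV hy)).2 i
      have hss := hfin.countable.isTotallyDisconnected _ subset_rfl him
      have := hss ⟨x', hx', rfl⟩ ⟨φ t, mem_connectedComponentIn hmem, rfl⟩
      simp only at this
      rw [this, hinv, glue_head]
    refine ⟨⟨tailv (mexp P' x'), fun i => mexp_ne_zero _ _ hx'V.1 _⟩, ?_⟩
    rw [hφ]
    have h5 := glue_tailv hrn (mexp P' x')
    rw [show (fun i : Fin r => mexp P' x' (Fin.castLE hrn i)) = c from funext hhead] at h5
    simp only [h5]
    rw [← mexp_mul _ _ _ hx'V.1, h2, mexp_one]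


theorem stmt11 {n m : ℕ} (A : Matrix (Fin n) (Fin m) ℤ) (r : ℕ)
    (hr : r = (A.map (Int.cast : ℤ → ℚ)).rank)
    (P : Matrix (Fin n) (Fin n) ℤ) (Q : Matrix (Fin m) (Fin m) ℤ)
    (hP : P.det = 1 ∨ P.det = -1) (hQ : Q.det = 1 ∨ Q.det = -1)
    (d : Fin r → ℤ) (hd : ∀ i, d i ≠ 0)
    (hSNF : ∀ (i : Fin n) (j : Fin m),
      (P * A * Q) i j =
        if h : (i : ℕ) = (j : ℕ) ∧ (i : ℕ) < r then d ⟨(i : ℕ), h.2⟩ else 0)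
    (b : Fin m → ℂ) (hb : ∀ j, b j ≠ 0)
    -- consistency condition `b^{Q₀} = (1,…,1)`
    (hcons : ∀ j : Fin (m - r),
      ∏ i, b i ^ Q i ⟨r + (j : ℕ), by have := j.isLt; omega⟩ = 1)
    (ζ : Fin r → ℂ) (hζ0 : ∀ j, ζ j ≠ 0)
    (hζ : ∀ j : Fin r, ζ j ^ d j = ∏ i, b i ^ Q i ⟨(j : ℕ), by
      have h1 := j.isLt
      have h2 := Matrix.rank_le_card_width (A.map (Int.cast : ℤ → ℚ))
      simp only [Fintype.card_fin] at h2
      omega⟩)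
    (V : Set (Fin n → ℂ))
    (hV : V = {x : Fin n → ℂ | (∀ i, x i ≠ 0) ∧ ∀ j, ∏ i, x i ^ A i j = b j}) :
    let X := {t : Fin (n - r) → ℂ // ∀ i, t i ≠ 0}
    let φ : (Fin r → ℕ) → X → (Fin n → ℂ) := fun k t j =>
      ∏ i : Fin n,
        (if h : (i : ℕ) < r then
          Complex.exp (2 * (Real.pi : ℂ) * Complex.I *
              ((k ⟨(i : ℕ), h⟩ : ℕ) : ℂ) / ((d ⟨(i : ℕ), h⟩ : ℤ) : ℂ)) * ζ ⟨(i : ℕ), h⟩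
        else t.1 ⟨(i : ℕ) - r, by have := i.isLt; omega⟩) ^ P i j
    (∀ k : Fin r → ℕ, (∀ j, k j < (d j).natAbs) →
      Topology.IsEmbedding (φ k) ∧ Set.range (φ k) ⊆ V ∧
        ∀ x ∈ Set.range (φ k), connectedComponentIn V x = Set.range (φ k)) ∧
    (∀ x ∈ V, Nonempty (↥(connectedComponentIn V x) ≃ₜ X)) := by

  intro X φ
  have hrn : r ≤ n := by
    have h2 := Matrix.rank_le_card_height (A.map (Int.cast : ℤ → ℚ))
    simp only [Fintype.card_fin] at h2
    omega
  have hrm : r ≤ m := by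
    have h2 := Matrix.rank_le_card_width (A.map (Int.cast : ℤ → ℚ))
    simp only [Fintype.card_fin] at h2
    omega
  have hPu : IsUnit P.det := Int.isUnit_iff.2 hP
  have hQu : IsUnit Q.det := Int.isUnit_iff.2 hQ
  have h1 : P * P⁻¹ = 1 := Matrix.mul_nonsing_inv _ hPu
  have h2 : P⁻¹ * P = 1 := Matrix.nonsing_inv_mul _ hPu
  have hQ1 : Q * Q⁻¹ = 1 := Matrix.mul_nonsing_inv _ hQu
  -- the Smith form acts diagonally
  have hdiag : ∀ y : Fin n → ℂ, ∀ j : Fin m, mexp (P * A * Q) y j =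
      if h : (j : ℕ) < r then y ⟨j, by omega⟩ ^ d ⟨j, h⟩ else 1 := by
    intro y j
    simp only [mexp, hSNF]
    split_ifs with h
    · rw [Finset.prod_eq_single (⟨j, by omega⟩ : Fin n)]
      · simp [h]
      · intro i _ hij
        have : ¬ ((i : ℕ) = (j : ℕ) ∧ (i : ℕ) < r) := fun h' => hij (Fin.ext h'.1)
        simp [this]
      · simp
    · refine Finset.prod_eq_one fun i _ => ?_
      have : ¬ ((i : ℕ) = (j : ℕ) ∧ (i : ℕ) < r) := by omega
      simp [this]
  have hbQ : ∀ j : Fin m, mexp Q b j = if h : (j : ℕ) < r then ζ ⟨j, h⟩ ^ d ⟨j, h⟩ else 1 := by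
    intro j
    split_ifs with h
    · rw [hζ]; rfl
    · have h3 := hcons ⟨(j : ℕ) - r, by have := j.isLt; omega⟩
      have h4 : (⟨r + ((j : ℕ) - r), by have := j.isLt; omega⟩ : Fin m) = j := by
        ext; simp; omega
      simp only [h4] at h3
      exact h3
  have hV' : ∀ x, x ∈ V ↔ (∀ i, x i ≠ 0) ∧
      ∀ i : Fin r, (mexp P⁻¹ x (Fin.castLE hrn i)) ^ d i = ζ i ^ d i := by
    intro x
    rw [hV]
    simp only [Set.mem_setOf_eq]
    refine and_congr_right fun hx => ?_
    have hy := mexp_ne_zero P⁻¹ x hx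
    have hA : mexp (P * A * Q) (mexp P⁻¹ x) = mexp Q (mexp A x) := by
      rw [← mexp_mul _ _ _ hx, Matrix.mul_assoc, ← Matrix.mul_assoc, h2, Matrix.one_mul,
        mexp_mul _ _ _ hx]
    have e1 : (∀ j, ∏ i, x i ^ A i j = b j) ↔ mexp A x = b :=
      ⟨fun h => funext h, fun h j => congrFun h j⟩
    have e2 : mexp A x = b ↔ mexp Q (mexp A x) = mexp Q b := by
      refine ⟨fun h => by rw [h], fun h => ?_⟩
      have := congrArg (mexp Q⁻¹) h
      rwa [← mexp_mul _ _ _ (mexp_ne_zero A x hx), ← mexp_mul _ _ _ hb, hQ1, mexp_one,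
        mexp_one] at this
    rw [e1, e2, ← hA]
    constructor
    · intro h i
      have h3 := congrFun h (Fin.castLE hrm i)
      rw [hdiag, hbQ] at h3
      simp only [Fin.val_castLE, Fin.is_lt, dite_true] at h3
      exact h3
    · intro h
      funext j
      rw [hdiag, hbQ]
      split_ifs with hj
      · exact h ⟨j, hj⟩
      · rfl
  refine ⟨fun k _ => ?_, fun x hx => ?_⟩
  · refine core hrn P P⁻¹ h1 h2 d hd (fun i => ζ i ^ d i) V hV'
      (fun i => Complex.exp (2 * (Real.pi : ℂ) * Complex.I * ((k i : ℕ) : ℂ) / ((d i : ℤ) : ℂ))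
        * ζ i) (fun i => mul_ne_zero (Complex.exp_ne_zero _) (hζ0 i)) (fun i => ?_) (φ k)
      (fun t => rfl)
    have hdc : ((d i : ℤ) : ℂ) ≠ 0 := by exact_mod_cast hd i
    rw [mul_zpow, ← Complex.exp_int_mul, mul_div_cancel₀ _ hdc]
    have : Complex.exp (2 * (Real.pi : ℂ) * Complex.I * ((k i : ℕ) : ℂ)) = 1 := by
      rw [mul_comm]; exact Complex.exp_nat_mul_two_pi_mul_I (k i)
    rw [this, one_mul]
  · have hx' := (hV' x).1 hx
    obtain ⟨hemb, -, hcomp⟩ := core hrn P P⁻¹ h1 h2 d hd (fun i => ζ i ^ d i) V hV'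
      (fun i => mexp P⁻¹ x (Fin.castLE hrn i)) (fun i => mexp_ne_zero _ _ hx'.1 _) hx'.2
      (fun t => mexp P (glue (fun i => mexp P⁻¹ x (Fin.castLE hrn i)) t.1)) (fun t => rfl)
    have hmem : x ∈ Set.range (fun t : X =>
        mexp P (glue (fun i => mexp P⁻¹ x (Fin.castLE hrn i)) t.1)) := by
      refine ⟨⟨tailv (mexp P⁻¹ x), fun i => mexp_ne_zero _ _ hx'.1 _⟩, ?_⟩
      simp only [glue_tailv]
      rw [← mexp_mul _ _ _ hx'.1, h2, mexp_one]
    rw [hcomp x hmem]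
    exact ⟨hemb.toHomeomorph.symm⟩
end

section
/- Let p_0^{(1)}, …, p_0^{(n)} ∈ ℤ^d. There exists a nonempty Zariski-open subset U of the coefficient space ℂ^{d×(n+1)} such that for every (c_{i,j}) ∈ U (1 ≤ i ≤ d, 0 ≤ j ≤ n): the solution set in (ℂˣ)^d of the system ∑_{j=1}^n c_{i,j} t^{p_0^{(j)}} = c_{i,0} (i = 1, …, d) is finite and its cardinality equals d! · Vol_d(conv({p_0^{(1)}, …, p_0^{(n)}} ∪ {0})), where Vol_d is d-dimensional Lebesgue measure and conv is the convex hull in ℝ^d. -/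
open MeasureTheory
open scoped ENNReal

open MvPolynomial in
lemma kush_dichotomy {ι τ ε : Type} [Finite ι] [Finite τ]
    (F : ε → MvPolynomial (ι ⊕ τ) ℂ) :
    (∃ p : MvPolynomial ι ℂ, p ≠ 0 ∧ ∀ c, eval c p ≠ 0 →
      ∃ x : τ → ℂ, ∀ e, eval (Sum.elim c x) (F e) = 0) ∨
    (∃ p : MvPolynomial ι ℂ, p ≠ 0 ∧ ∀ c, eval c p ≠ 0 →
      ¬ ∃ x : τ → ℂ, ∀ e, eval (Sum.elim c x) (F e) = 0) := by
  classical
  let I : Ideal (MvPolynomial (ι ⊕ τ) ℂ) := Ideal.span (Set.range F)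
  let φ : MvPolynomial ι ℂ →+* (MvPolynomial (ι ⊕ τ) ℂ ⧸ I) :=
    (Ideal.Quotient.mk I).comp (rename (R := ℂ) (Sum.inl : ι → ι ⊕ τ)).toRingHom
  by_cases hφ : Function.Injective φ
  · left
    have hft : φ.FiniteType := by
      apply RingHom.FiniteType.of_comp_finiteType (f := (C : ℂ →+* MvPolynomial ι ℂ))
      have : φ.comp C = algebraMap ℂ (MvPolynomial (ι ⊕ τ) ℂ ⧸ I) := by
        ext x
        simp only [φ, RingHom.comp_apply]
        simp
        rfl
      rw [this]
      exact RingHom.finiteType_algebraMap.mpr inferInstance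
    have hfp : φ.FinitePresentation := RingHom.FinitePresentation.of_finiteType.mp hft
    obtain ⟨S, hS⟩ := PrimeSpectrum.exists_constructibleSetData_iff.mpr
      (PrimeSpectrum.isConstructible_range_comap hfp)
    have hbot : (⊥ : PrimeSpectrum (MvPolynomial ι ℂ)) ∈ Set.range (PrimeSpectrum.comap φ) := by
      obtain ⟨q, hq, h2⟩ := Ideal.exists_comap_eq_of_mem_minimalPrimes_of_injective hφ ⊥
        (by rw [IsDomain.minimalPrimes_eq_singleton_bot]; rfl)
      refine ⟨⟨q, hq⟩, ?_⟩
      ext1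
      exact h2
    rw [← hS] at hbot
    simp only [PrimeSpectrum.ConstructibleSetData.toSet, Set.mem_iUnion] at hbot
    obtain ⟨D, hD, h1, h2⟩ := hbot
    have hg : ∀ i, D.g i = 0 := by
      intro i
      have := h1 ⟨i, rfl⟩
      simpa using this
    have hf : D.f ≠ 0 := by
      intro h
      apply h2
      simp [h]
    refine ⟨D.f, hf, fun c hc => ?_⟩
    let m : PrimeSpectrum (MvPolynomial ι ℂ) := ⟨RingHom.ker (eval c), RingHom.ker_isPrime _⟩
    have hm : m ∈ Set.range (PrimeSpectrum.comap φ) := by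
      rw [← hS]
      simp only [PrimeSpectrum.ConstructibleSetData.toSet, Set.mem_iUnion]
      refine ⟨D, hD, ?_, ?_⟩
      · rintro _ ⟨i, rfl⟩
        simp [hg]
      · intro h
        have := h (Set.mem_singleton _)
        exact hc this
    obtain ⟨q, hq⟩ := hm
    have hq' : ∀ r, φ r ∈ q.asIdeal ↔ eval c r = 0 := by
      intro r
      have := congrArg (fun z => r ∈ z.asIdeal) hq
      simpa [m, RingHom.mem_ker] using this
    let Q := q.asIdeal.comap (Ideal.Quotient.mk I)
    have hQ : Q ≠ ⊤ := (Ideal.IsPrime.comap _ (hK := q.isPrime)).ne_top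
    obtain ⟨M, hM, hQM⟩ := Ideal.exists_le_maximal Q hQ
    obtain ⟨x, hx⟩ := (isMaximal_iff_eq_vanishingIdeal_singleton).mp hM
    have hMx : ∀ r ∈ Q, eval x r = 0 := by
      intro r hr
      have := hQM hr
      rw [hx, mem_vanishingIdeal_singleton_iff] at this
      simpa using this
    have hxc : ∀ i, x (Sum.inl i) = c i := by
      intro i
      have h1 : rename Sum.inl (X i - C (c i) : MvPolynomial ι ℂ) ∈ Q := by
        have := (hq' (X i - C (c i))).mpr (by simp)
        exact this
      have := hMx _ h1
      simp at this
      linear_combination this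
    refine ⟨fun t => x (Sum.inr t), fun e => ?_⟩
    have : Sum.elim c (fun t => x (Sum.inr t)) = x := by
      ext (i | t)
      · simp [hxc]
      · simp
    rw [this]
    apply hMx
    have : Ideal.Quotient.mk I (F e) = 0 :=
      Ideal.Quotient.eq_zero_iff_mem.mpr (Ideal.subset_span ⟨e, rfl⟩)
    simp [Q, Ideal.mem_comap, this]
  · right
    rw [injective_iff_map_eq_zero] at hφ
    push Not at hφ
    obtain ⟨p, hp, hp0⟩ := hφ
    refine ⟨p, hp0, fun c hc => ?_⟩
    rintro ⟨x, hx⟩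
    apply hc
    have h1 : rename Sum.inl p ∈ I := Ideal.Quotient.eq_zero_iff_mem.mp hp
    have h2 : I ≤ RingHom.ker (eval (Sum.elim c x)) := by
      rw [Ideal.span_le]
      rintro _ ⟨e, rfl⟩
      exact hx e
    have := h2 h1
    rw [RingHom.mem_ker, eval_rename] at this
    simpa using this


/-- The solution set of the system, with coefficients indexed by pairs. -/
def kushS {d n : ℕ} (p0 : Fin n → Fin d → ℤ) (c : Fin d × Fin (n + 1) → ℂ) : Set (Fin d → ℂ) :=
  {t | (∀ i, t i ≠ 0) ∧ ∀ i, ∑ j : Fin n, c (i, j.succ) * ∏ l, t l ^ p0 j l = c (i, 0)}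

lemma kush_le_encard {α : Type*} (S : Set α) (k : ℕ) :
    (k : ℕ∞) ≤ S.encard ↔ ∃ f : Fin k → α, Function.Injective f ∧ ∀ r, f r ∈ S := by
  constructor
  · intro h
    obtain ⟨T, hT, hk⟩ := Set.exists_subset_encard_eq h
    have hfin : T.Finite := Set.finite_of_encard_eq_coe hk
    have hc : Nat.card T = k := by
      have := hfin.cast_ncard_eq
      rw [hk] at this
      rw [Nat.card_coe_set_eq]
      exact_mod_cast this
    have : Finite T := hfin
    let e := (Finite.equivFinOfCardEq hc).symm
    exact ⟨fun r => (e r : α), Subtype.val_injective.comp e.injective, fun r => hT (e r).2⟩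
  · rintro ⟨f, hf, hS⟩
    have : (Set.range f).encard ≤ S.encard := Set.encard_le_encard (by rintro _ ⟨r, rfl⟩; exact hS r)
    rw [← Set.image_univ, hf.encard_image] at this
    simpa using this

lemma kush_zpow (t s : ℂ) (h : t * s = 1) (m : ℤ) : t ^ m = t ^ m.toNat * s ^ (-m).toNat := by
  have ht : t ≠ 0 := left_ne_zero_of_mul_eq_one h
  have hs : s = t⁻¹ := (eq_inv_of_mul_eq_one_right h)
  subst hs
  rw [inv_pow, ← zpow_natCast, ← zpow_natCast, ← zpow_neg, ← zpow_add₀ ht]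
  congr 1
  omega

open MvPolynomial in
lemma kush_dich_count {d n : ℕ} (p0 : Fin n → Fin d → ℤ) (k : ℕ) :
    (∃ p : MvPolynomial (Fin d × Fin (n + 1)) ℂ, p ≠ 0 ∧ ∀ c, eval c p ≠ 0 →
      (k : ℕ∞) ≤ (kushS p0 c).encard) ∨
    (∃ p : MvPolynomial (Fin d × Fin (n + 1)) ℂ, p ≠ 0 ∧ ∀ c, eval c p ≠ 0 →
      ¬ (k : ℕ∞) ≤ (kushS p0 c).encard) := by
  classical
  -- the variables: coordinates, inverses, witnesses of distinctness
  let τ : Type := (Fin k × Fin d) ⊕ ((Fin k × Fin d) ⊕ (Fin k × Fin k × Fin d))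
  let ι : Type := Fin d × Fin (n + 1)
  let c' : ι → MvPolynomial (ι ⊕ τ) ℂ := fun i => X (Sum.inl i)
  let t' : Fin k → Fin d → MvPolynomial (ι ⊕ τ) ℂ := fun r l => X (Sum.inr (Sum.inl (r, l)))
  let s' : Fin k → Fin d → MvPolynomial (ι ⊕ τ) ℂ :=
    fun r l => X (Sum.inr (Sum.inr (Sum.inl (r, l))))
  let w' : Fin k → Fin k → Fin d → MvPolynomial (ι ⊕ τ) ℂ :=
    fun r r' l => X (Sum.inr (Sum.inr (Sum.inr (r, r', l))))
  let F : (Fin k × Fin d) ⊕ ((Fin k × Fin d) ⊕ {q : Fin k × Fin k // q.1 ≠ q.2}) →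
      MvPolynomial (ι ⊕ τ) ℂ :=
    Sum.elim (fun q => t' q.1 q.2 * s' q.1 q.2 - 1)
      (Sum.elim
        (fun q => (∑ j : Fin n, c' (q.2, j.succ) *
          ∏ l, (t' q.1 l ^ (p0 j l).toNat * s' q.1 l ^ (-(p0 j l)).toNat)) - c' (q.2, 0))
        (fun q => (∑ l, w' q.1.1 q.1.2 l * (t' q.1.1 l - t' q.1.2 l)) - 1))
  have key : ∀ c : ι → ℂ, (∃ x : τ → ℂ, ∀ e, eval (Sum.elim c x) (F e) = 0) ↔
      (k : ℕ∞) ≤ (kushS p0 c).encard := by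
    intro c
    rw [kush_le_encard]
    constructor
    · rintro ⟨x, hx⟩
      have h1 : ∀ r l, x (Sum.inl (r, l)) * x (Sum.inr (Sum.inl (r, l))) = 1 := by
        intro r l
        have := hx (Sum.inl (r, l))
        simp [F, t', s'] at this
        linear_combination this
      refine ⟨fun r l => x (Sum.inl (r, l)), ?_, ?_⟩
      · intro r r' hrr
        by_contra hne
        have := hx (Sum.inr (Sum.inr ⟨(r, r'), hne⟩))
        simp [F, t', w'] at this
        have h2 : ∀ l, x (Sum.inl (r, l)) = x (Sum.inl (r', l)) := fun l => congrFun hrr l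
        simp [h2] at this
      · intro r
        refine ⟨fun l => left_ne_zero_of_mul_eq_one (h1 r l), fun i => ?_⟩
        have := hx (Sum.inr (Sum.inl (r, i)))
        simp [F, t', s', c'] at this
        rw [sub_eq_zero] at this
        rw [← this]
        refine Finset.sum_congr rfl fun j _ => ?_
        congr 1
        exact Finset.prod_congr rfl fun l _ => kush_zpow _ _ (h1 r l) _
    · rintro ⟨f, hf, hS⟩
      have hne : ∀ r r', r ≠ r' → ∃ l, f r l ≠ f r' l := by
        intro r r' h
        by_contra! hcon
        exact h (hf (funext hcon))
      let L : Fin k → Fin k → Fin d → ℂ := fun r r' l =>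
        if h : r ≠ r' then
          (if l = (hne r r' h).choose then (f r l - f r' l)⁻¹ else 0) else 0
      refine ⟨Sum.elim (fun q => f q.1 q.2) (Sum.elim (fun q => (f q.1 q.2)⁻¹)
        (fun q => L q.1 q.2.1 q.2.2)), ?_⟩
      rintro (⟨r, l⟩ | ⟨r, i⟩ | ⟨⟨r, r'⟩, hr⟩)
      · simp [F, t', s', (hS r).1 l]
      · simp [F, t', s', c']
        rw [sub_eq_zero, ← (hS r).2 i]
        refine Finset.sum_congr rfl fun j _ => ?_
        congr 1
        refine Finset.prod_congr rfl fun l _ => ?_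
        rw [kush_zpow (f r l) (f r l)⁻¹ (mul_inv_cancel₀ ((hS r).1 l)) (p0 j l), inv_pow]
      · have hr' : r ≠ r' := hr
        have hl := (hne r r' hr').choose_spec
        simp only [F, t', w', Sum.elim_inr, map_sub, map_sum, map_mul, eval_X, map_one,
          Sum.elim_inl, L, dif_pos hr', ite_mul, zero_mul]
        rw [Finset.sum_eq_single (hne r r' hr').choose (fun b _ hb => if_neg hb) (by simp),
          if_pos rfl, inv_mul_cancel₀ (sub_ne_zero.mpr hl), sub_self]
  rcases kush_dichotomy F with ⟨p, hp, h⟩ | ⟨p, hp, h⟩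
  · exact Or.inl ⟨p, hp, fun c hc => (key c).mp (h c hc)⟩
  · exact Or.inr ⟨p, hp, fun c hc hk => h c hc ((key c).mpr hk)⟩


lemma kush_null_fin (m : ℕ) (p : MvPolynomial (Fin m) ℂ) (hp : p ≠ 0) :
    volume {x : Fin m → ℂ | MvPolynomial.eval x p = 0} = 0 := by
  induction m with
  | zero =>
    have : {x : Fin 0 → ℂ | MvPolynomial.eval x p = 0} = ∅ := by
      ext x
      simp only [Set.mem_ofPred_eq, Set.mem_empty_iff_false, iff_false]
      intro h
      apply hp
      apply MvPolynomial.funext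
      intro y
      rw [Subsingleton.elim y x, h, map_zero]
    rw [this, measure_empty]
  | succ m ih =>
    have hq : MvPolynomial.finSuccEquiv ℂ m p ≠ 0 := by
      simpa using hp
    obtain ⟨i, hi⟩ : ∃ i, (MvPolynomial.finSuccEquiv ℂ m p).coeff i ≠ 0 := by
      by_contra! h
      exact hq (Polynomial.ext (by simpa using h))
    have h0 := ih _ hi
    have hpres := volume_preserving_piFinSuccAbove (fun _ : Fin (m + 1) => ℂ) 0
    have hmeas : MeasurableSet {x : Fin (m + 1) → ℂ | MvPolynomial.eval x p = 0} :=
      (isClosed_eq (MvPolynomial.continuous_eval p) continuous_const).measurableSet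
    rw [← hpres.symm.measure_preimage hmeas.nullMeasurableSet]
    have hmeas2 := hpres.symm.measurable hmeas
    rw [Measure.volume_eq_prod, Measure.prod_apply_symm hmeas2]
    rw [lintegral_eq_zero_iff (measurable_measure_prodMk_right hmeas2)]
    have : ∀ᵐ s : Fin m → ℂ, MvPolynomial.eval s
        ((MvPolynomial.finSuccEquiv ℂ m p).coeff i) ≠ 0 := by
      rw [ae_iff]
      simpa using h0
    filter_upwards [this] with s hs
    apply Set.Finite.measure_zero
    let P := Polynomial.map (MvPolynomial.eval s) (MvPolynomial.finSuccEquiv ℂ m p)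
    have hP : P ≠ 0 := by
      intro h
      apply hs
      have := congrArg (fun q => Polynomial.coeff q i) h
      simpa [P, Polynomial.coeff_map] using this
    refine (Polynomial.finite_setOfPred_isRoot hP).subset ?_
    intro y hy
    simp only [Set.mem_preimage, Set.mem_ofPred_eq] at hy
    have h2 : (MeasurableEquiv.piFinSuccAbove (fun _ : Fin (m + 1) => ℂ) 0).symm (y, s) =
        (Fin.cons y s : Fin (m + 1) → ℂ) := by
      ext j
      simp [MeasurableEquiv.piFinSuccAbove, Fin.insertNthEquiv]
    rw [h2, MvPolynomial.eval_eq_eval_mv_eval'] at hy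
    exact hy

lemma kush_null {σ V : Type} [Finite σ] [NormedAddCommGroup V] [NormedSpace ℝ V]
    [FiniteDimensional ℝ V] [MeasurableSpace V] [BorelSpace V] (μ : Measure V)
    [μ.IsAddHaarMeasure] (L : V ≃ₗ[ℝ] (σ → ℂ))
    (p : MvPolynomial σ ℂ) (hp : p ≠ 0) :
    μ {v | MvPolynomial.eval (L v) p = 0} = 0 := by
  classical
  obtain ⟨m, ⟨e⟩⟩ := Finite.exists_equiv_fin σ
  let p' := MvPolynomial.rename e p
  have hp' : p' ≠ 0 := fun h => hp
    (MvPolynomial.rename_injective e e.injective (by simpa [p'] using h))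
  let L' : V ≃ₗ[ℝ] (Fin m → ℂ) := L.trans (LinearEquiv.funCongrLeft ℝ ℂ e.symm)
  have h0 := kush_null_fin m p' hp'
  have hH : (μ.map L').IsAddHaarMeasure :=
    ContinuousLinearEquiv.isAddHaarMeasure_map L'.toContinuousLinearEquiv μ
  have hc : Continuous L' := LinearMap.continuous_of_finiteDimensional L'.toLinearMap
  have hmeas : MeasurableSet {x : Fin m → ℂ | MvPolynomial.eval x p' = 0} :=
      (isClosed_eq (MvPolynomial.continuous_eval p') continuous_const).measurableSet
  have hx := Measure.isAddLeftInvariant_eq_smul (μ.map L') (volume : Measure (Fin m → ℂ))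
  have : (μ.map L') {x : Fin m → ℂ | MvPolynomial.eval x p' = 0} = 0 := by
    rw [hx, Measure.smul_apply, kush_null_fin m p' hp', smul_zero]
  rw [Measure.map_apply hc.measurable hmeas] at this
  convert this using 2
  ext v
  simp only [Set.mem_ofPred_eq, Set.mem_preimage, p', MvPolynomial.eval_rename]
  have : (L' v) ∘ e = L v := by
    ext i
    simp [L', LinearEquiv.funCongrLeft]
  rw [this]

lemma kush_area {E : Type*} [NormedAddCommGroup E] [NormedSpace ℝ E] [FiniteDimensional ℝ E]
    [MeasurableSpace E] [BorelSpace E] (μ : Measure E) [μ.IsAddHaarMeasure]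
    (f : E → E) (f' : E → E →L[ℝ] E) (hf : ContDiff ℝ 1 f) (hf' : ∀ x, HasFDerivAt f (f' x) x)
    (s : Set E) (hs : MeasurableSet s) (g : E → ℝ≥0∞) (hg : Measurable g) :
    ∫⁻ y, ((s ∩ f ⁻¹' {y}).encard : ℝ≥0∞) * g y ∂μ =
      ∫⁻ x in s, ENNReal.ofReal |(f' x).det| * g (f x) ∂μ := by
  have hf'c : Continuous f' := by
    have : f' = fderiv ℝ f := funext fun x => ((hf' x).fderiv).symm
    rw [this]
    exact hf.continuous_fderiv (by norm_num)
  have hdet : Continuous fun x => (f' x).det := ContinuousLinearMap.continuous_det.comp hf'c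
  let s0 := s ∩ {x | (f' x).det = 0}
  let s1 := s ∩ {x | (f' x).det ≠ 0}
  have hs1 : MeasurableSet s1 := hs.inter (isOpen_ne_fun hdet continuous_const).measurableSet
  have hs0 : MeasurableSet s0 := hs.inter (isClosed_eq hdet continuous_const).measurableSet
  have hnull : μ (f '' s0) = 0 := addHaar_image_eq_zero_of_det_fderivWithin_eq_zero μ
    (fun x _ => (hf' x).hasFDerivWithinAt) (fun x hx => hx.2)
  -- local injectivity
  have hloc : ∀ x ∈ s1, ∃ u : Set E, IsOpen u ∧ x ∈ u ∧ Set.InjOn f u := by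
    intro x hx
    have hst : HasStrictFDerivAt f (f' x) x := by
      have := hf.contDiffAt.hasStrictFDerivAt (x := x) (by norm_num)
      rwa [(hf' x).fderiv] at this
    let e := (f' x).toContinuousLinearEquivOfDetNeZero hx.2
    have hst' : HasStrictFDerivAt f (e : E →L[ℝ] E) x := by
      simpa [e] using hst
    refine ⟨(hst'.toOpenPartialHomeomorph f).source,
      (hst'.toOpenPartialHomeomorph f).open_source, hst'.mem_toOpenPartialHomeomorph_source, ?_⟩
    exact (hst'.toOpenPartialHomeomorph f).injOn
  choose! u hu1 hu2 hu3 using hloc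
  obtain ⟨T, hT, hTc, hTu⟩ := TopologicalSpace.countable_cover_nhdsWithin (s := s1)
    (f := u) (fun x hx => mem_nhdsWithin_of_mem_nhds ((hu1 x hx).mem_nhds (hu2 x hx)))
  obtain ⟨v, hv1, hv2, hv3⟩ : ∃ v : ℕ → Set E, (∀ k, IsOpen (v k)) ∧ (∀ k, Set.InjOn f (v k)) ∧
      s1 ⊆ ⋃ k, v k := by
    rcases T.eq_empty_or_nonempty with h | h
    · refine ⟨fun _ => ∅, fun _ => isOpen_empty, fun _ => Set.injOn_empty _, ?_⟩
      simpa [h] using hTu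
    · obtain ⟨q, hq⟩ := hTc.exists_eq_range h
      have hqT : ∀ k, q k ∈ s1 := fun k => hT (hq ▸ ⟨k, rfl⟩)
      refine ⟨fun k => u (q k), fun k => hu1 _ (hqT k), fun k => hu3 _ (hqT k), ?_⟩
      refine hTu.trans ?_
      rw [hq]
      simp
  let w : ℕ → Set E := fun k => s1 ∩ disjointed v k
  have hwm : ∀ k, MeasurableSet (w k) := fun k =>
    hs1.inter (MeasurableSet.disjointed (fun i => (hv1 i).measurableSet) k)
  have hwd : Pairwise (Function.onFun Disjoint w) := fun i j hij =>
    ((disjoint_disjointed v) hij).mono Set.inter_subset_right Set.inter_subset_right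
  have hwu : ⋃ k, w k = s1 := by
    simp only [w]
    rw [← Set.inter_iUnion, iUnion_disjointed]
    exact Set.inter_eq_left.mpr hv3
  have hwi : ∀ k, Set.InjOn f (w k) := fun k =>
    (hv2 k).mono (Set.inter_subset_right.trans (disjointed_subset v k))
  have hcount : ∀ y, ((s1 ∩ f ⁻¹' {y}).encard : ℝ≥0∞) =
      ∑' k, (f '' w k).indicator (fun _ => (1 : ℝ≥0∞)) y := by
    intro y
    have hfy : MeasurableSet (f ⁻¹' {y}) := hf.continuous.measurable (measurableSet_singleton y)
    rw [← Measure.count_apply (hs1.inter hfy), ← hwu, Set.iUnion_inter,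
      measure_iUnion (fun i j hij => (hwd hij).mono Set.inter_subset_left Set.inter_subset_left)
        (fun k => (hwm k).inter hfy)]
    refine tsum_congr fun k => ?_
    rw [Measure.count_apply ((hwm k).inter hfy)]
    by_cases hy : y ∈ f '' w k
    · rw [Set.indicator_of_mem hy]
      obtain ⟨x, hx, rfl⟩ := hy
      have : w k ∩ f ⁻¹' {f x} = {x} := by
        ext z
        constructor
        · rintro ⟨hz, hz2⟩
          exact hwi k hz hx hz2
        · rintro rfl
          exact ⟨hx, rfl⟩
      rw [this]
      simp
    · rw [Set.indicator_of_notMem hy]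
      have : w k ∩ f ⁻¹' {y} = ∅ := by
        ext z
        simp only [Set.mem_inter_iff, Set.mem_preimage, Set.mem_singleton_iff,
          Set.mem_empty_iff_false, iff_false]
        rintro ⟨hz, hz2⟩
        exact hy ⟨z, hz, hz2⟩
      rw [this]
      simp
  have himm : ∀ k, MeasurableSet (f '' w k) := fun k =>
    measurable_image_of_fderivWithin (hwm k) (fun x _ => (hf' x).hasFDerivWithinAt) (hwi k)
  have hL : ∫⁻ y, ((s ∩ f ⁻¹' {y}).encard : ℝ≥0∞) * g y ∂μ =
      ∫⁻ y, ((s1 ∩ f ⁻¹' {y}).encard : ℝ≥0∞) * g y ∂μ := by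
    apply lintegral_congr_ae
    have : ∀ᵐ y ∂μ, y ∉ f '' s0 := measure_eq_zero_iff_ae_notMem.mp hnull
    filter_upwards [this] with y hy
    have : s ∩ f ⁻¹' {y} = s1 ∩ f ⁻¹' {y} := by
      ext z
      constructor
      · rintro ⟨hz, hz2⟩
        exact ⟨⟨hz, fun h0 => hy ⟨z, ⟨hz, h0⟩, hz2⟩⟩, hz2⟩
      · rintro ⟨hz, hz2⟩
        exact ⟨hz.1, hz2⟩
    rw [this]
  have hR : ∫⁻ x in s, ENNReal.ofReal |(f' x).det| * g (f x) ∂μ =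
      ∫⁻ x in s1, ENNReal.ofReal |(f' x).det| * g (f x) ∂μ := by
    have hsd : s = s0 ∪ s1 := by
      ext z
      simp only [s0, s1, Set.mem_union, Set.mem_inter_iff, Set.mem_ofPred_eq]
      tauto
    have hdj : Disjoint s0 s1 := by
      rw [Set.disjoint_left]
      intro z hz hz1
      exact hz1.2 hz.2
    conv_lhs => rw [hsd]
    rw [lintegral_union hs1 hdj]
    have : ∫⁻ x in s0, ENNReal.ofReal |(f' x).det| * g (f x) ∂μ = 0 := by
      rw [setLIntegral_congr_fun (g := fun _ => 0) hs0]
      · simp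
      · intro x hx
        have : (f' x).det = 0 := hx.2
        simp [this]
    rw [this, zero_add]
  rw [hL, hR]
  simp_rw [hcount, ← ENNReal.tsum_mul_right]
  have hmm : ∀ k, AEMeasurable
      (fun y => (f '' w k).indicator (fun _ => (1 : ℝ≥0∞)) y * g y) μ := fun k =>
    ((measurable_const.indicator (himm k)).mul hg).aemeasurable
  rw [lintegral_tsum hmm]
  rw [← hwu, lintegral_iUnion hwm hwd]
  refine tsum_congr fun k => ?_
  rw [← lintegral_image_eq_lintegral_abs_det_fderiv_mul μ (hwm k)
    (fun x _ => (hf' x).hasFDerivWithinAt) (hwi k), ← lintegral_indicator (himm k)]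
  refine lintegral_congr fun y => ?_
  by_cases hy : y ∈ f '' w k <;> simp [hy]


open ComplexConjugate in
lemma kush_g1 : Integrable (fun z : ℂ => ((Real.exp (-‖z‖ ^ 2) : ℝ) : ℂ)) ∧
    Integrable (fun z : ℂ => z * ((Real.exp (-‖z‖ ^ 2) : ℝ) : ℂ)) ∧
    Integrable (fun z : ℂ => conj z * ((Real.exp (-‖z‖ ^ 2) : ℝ) : ℂ)) ∧
    Integrable (fun z : ℂ => z * conj z * ((Real.exp (-‖z‖ ^ 2) : ℝ) : ℂ)) ∧
    (∫ z : ℂ, ((Real.exp (-‖z‖ ^ 2) : ℝ) : ℂ)) = Real.pi ∧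
    (∫ z : ℂ, z * ((Real.exp (-‖z‖ ^ 2) : ℝ) : ℂ)) = 0 ∧
    (∫ z : ℂ, conj z * ((Real.exp (-‖z‖ ^ 2) : ℝ) : ℂ)) = 0 ∧
    (∫ z : ℂ, z * conj z * ((Real.exp (-‖z‖ ^ 2) : ℝ) : ℂ)) = Real.pi := by
  have h : ∀ q : ℕ, ∫ x : ℂ, ‖x‖ ^ q * Real.exp (-‖x‖ ^ 2) =
      Real.pi * Real.Gamma (((q : ℝ) + 2) / 2) := by
    intro q
    have := Complex.integral_rpow_mul_exp_neg_rpow (p := 2) (q := q) (by norm_num)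
      (by have : (0 : ℝ) ≤ q := Nat.cast_nonneg q
          linarith)
    have e2 : ∀ x : ℂ, ‖x‖ ^ (2 : ℝ) = ‖x‖ ^ 2 := fun x => by
      rw [← Real.rpow_natCast]; norm_num
    simp only [Real.rpow_natCast, e2] at this
    rw [this]
    ring
  have hI : ∀ q : ℕ, Integrable fun x : ℂ => ‖x‖ ^ q * Real.exp (-‖x‖ ^ 2) := by
    intro q
    by_contra hcon
    have h1 := h q
    rw [integral_undef hcon] at h1
    have : 0 < Real.Gamma (((q : ℝ) + 2) / 2) := Real.Gamma_pos_of_pos (by positivity)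
    have := Real.pi_pos
    nlinarith [mul_pos this ‹0 < Real.Gamma (((q : ℝ) + 2) / 2)›]
  have i0 : Integrable (fun z : ℂ => ((Real.exp (-‖z‖ ^ 2) : ℝ) : ℂ)) := by
    have := (hI 0).ofReal (𝕜 := ℂ)
    simpa using this
  have i1 : Integrable (fun z : ℂ => z * ((Real.exp (-‖z‖ ^ 2) : ℝ) : ℂ)) := by
    refine (hI 1).mono' (by fun_prop) (Filter.Eventually.of_forall fun z => ?_)
    rw [norm_mul, Complex.norm_real, pow_one, Real.norm_of_nonneg (Real.exp_pos _).le]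
  have i2 : Integrable (fun z : ℂ => conj z * ((Real.exp (-‖z‖ ^ 2) : ℝ) : ℂ)) := by
    refine (hI 1).mono' (by fun_prop) (Filter.Eventually.of_forall fun z => ?_)
    rw [norm_mul, Complex.norm_real, pow_one, Real.norm_of_nonneg (Real.exp_pos _).le,
      RCLike.norm_conj]
  have i3 : Integrable (fun z : ℂ => z * conj z * ((Real.exp (-‖z‖ ^ 2) : ℝ) : ℂ)) := by
    have := (hI 2).ofReal (𝕜 := ℂ)
    refine this.congr (Filter.Eventually.of_forall fun z => ?_)
    simp [Complex.mul_conj']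
  have odd : ∀ f : ℂ → ℂ, (∀ z, f (-z) = - f z) → ∫ z, f z = 0 := by
    intro f hf
    have h1 := integral_neg_eq_self f volume
    simp_rw [hf] at h1
    rw [integral_neg] at h1
    linear_combination (-1 / 2 : ℂ) * h1
  refine ⟨i0, i1, i2, i3, ?_, odd _ (by simp), odd _ (by simp), ?_⟩
  · rw [integral_complex_ofReal]
    have := h 0
    simp at this
    rw [this]
  · have := h 2
    have hG : Real.Gamma (((2 : ℕ) + 2 : ℝ) / 2) = 1 := by
      norm_num
    rw [hG, mul_one] at this
    rw [← this, ← integral_complex_ofReal]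
    congr 1
    ext z
    simp [Complex.mul_conj']

open ComplexConjugate in
lemma kush_g2 (n : ℕ) (j k : Fin n) :
    Integrable (fun c : Fin n → ℂ =>
      c j * conj (c k) * ((Real.exp (-∑ i, ‖c i‖ ^ 2) : ℝ) : ℂ)) ∧
    ∫ c : Fin n → ℂ, c j * conj (c k) * ((Real.exp (-∑ i, ‖c i‖ ^ 2) : ℝ) : ℂ) =
      if j = k then (Real.pi : ℂ) ^ n else 0 := by
  obtain ⟨i0, i1, i2, i3, e0, e1, e2, e3⟩ := kush_g1
  let h : Fin n → ℂ → ℂ := fun i z => (if i = j then z else 1) * (if i = k then conj z else 1) *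
    ((Real.exp (-‖z‖ ^ 2) : ℝ) : ℂ)
  have hprod : (fun c : Fin n → ℂ => c j * conj (c k) * ((Real.exp (-∑ i, ‖c i‖ ^ 2) : ℝ) : ℂ))
      = fun c => ∏ i, h i (c i) := by
    ext c
    simp only [h, Finset.prod_mul_distrib, Finset.prod_ite_eq', Finset.mem_univ, if_true]
    rw [← Finset.sum_neg_distrib, Real.exp_sum, Complex.ofReal_prod]
  have hint : ∀ i, Integrable (h i) := by
    intro i
    by_cases h1 : i = j <;> by_cases h2 : i = k <;> simp only [h, h1, h2, if_true, if_false, one_mul, mul_one]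
    · subst h1; subst h2; simpa using i3
    · subst h1; simpa [h2] using i1
    · subst h2; simpa [h1] using i2
    · simpa [h1, h2] using i0
  rw [hprod]
  refine ⟨Integrable.fintype_prod hint, ?_⟩
  rw [integral_fintype_prod_volume_eq_prod]
  split_ifs with hjk
  · subst hjk
    have : ∀ i, ∫ z, h i z = Real.pi := by
      intro i
      by_cases h1 : i = j
      · simpa [h, h1] using e3
      · simpa [h, h1] using e0
    simp [this]
  · apply Finset.prod_eq_zero (Finset.mem_univ j)
    simpa [h, hjk] using e1

open ComplexConjugate in
lemma kush_g3 (n : ℕ) (a b : Fin n → ℂ) :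
    Integrable (fun c : Fin n → ℂ =>
      (∑ j, c j * a j) * conj (∑ j, c j * b j) * ((Real.exp (-∑ i, ‖c i‖ ^ 2) : ℝ) : ℂ)) ∧
    ∫ c : Fin n → ℂ,
      (∑ j, c j * a j) * conj (∑ j, c j * b j) * ((Real.exp (-∑ i, ‖c i‖ ^ 2) : ℝ) : ℂ) =
      (Real.pi : ℂ) ^ n * ∑ j, a j * conj (b j) := by
  have hexp : (fun c : Fin n → ℂ =>
      (∑ j, c j * a j) * conj (∑ j, c j * b j) * ((Real.exp (-∑ i, ‖c i‖ ^ 2) : ℝ) : ℂ)) =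
      fun c => ∑ j, ∑ k, (a j * conj (b k)) *
        (c j * conj (c k) * ((Real.exp (-∑ i, ‖c i‖ ^ 2) : ℝ) : ℂ)) := by
    ext c
    rw [map_sum, Finset.sum_mul_sum, Finset.sum_mul]
    refine Finset.sum_congr rfl fun j _ => ?_
    rw [Finset.sum_mul]
    refine Finset.sum_congr rfl fun k _ => ?_
    rw [map_mul]
    ring
  rw [hexp]
  have hI : ∀ j k, Integrable fun c : Fin n → ℂ => (a j * conj (b k)) *
        (c j * conj (c k) * ((Real.exp (-∑ i, ‖c i‖ ^ 2) : ℝ) : ℂ)) := fun j k =>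
    (kush_g2 n j k).1.const_mul _
  refine ⟨integrable_finsetSum _ fun j _ => integrable_finsetSum _ fun k _ => hI j k, ?_⟩
  rw [integral_finsetSum _ fun j _ => integrable_finsetSum _ fun k _ => hI j k]
  rw [Finset.mul_sum]
  refine Finset.sum_congr rfl fun j _ => ?_
  rw [integral_finsetSum _ fun k _ => hI j k]
  simp_rw [integral_const_mul, (kush_g2 n j _).2]
  simp [mul_comm]


open ComplexConjugate in
/-- The row integral. -/
lemma kush_g4 (n : ℕ) (v a b : Fin n → ℂ) (W : ℝ) (hW : W = ∑ j, ‖v j‖ ^ 2) :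
    Integrable (fun c : Fin n → ℂ =>
      (∑ j, c j * a j) * conj (∑ j, c j * b j) *
        ((Real.exp (-(‖∑ j, c j * v j‖ ^ 2 + ∑ i, ‖c i‖ ^ 2)) : ℝ) : ℂ)) ∧
    ∫ c : Fin n → ℂ,
      (∑ j, c j * a j) * conj (∑ j, c j * b j) *
        ((Real.exp (-(‖∑ j, c j * v j‖ ^ 2 + ∑ i, ‖c i‖ ^ 2)) : ℝ) : ℂ) =
      (Real.pi : ℂ) ^ n * ((∑ j, a j * conj (b j)) / (1 + W) -
        (∑ j, a j * conj (v j)) * conj (∑ j, b j * conj (v j)) / (1 + W) ^ 2) := by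
  have hW0 : 0 ≤ W := by rw [hW]; positivity
  set s : ℝ := Real.sqrt (1 + W) with hs
  have hs2 : s ^ 2 = 1 + W := Real.sq_sqrt (by linarith)
  have hs0 : 0 < s := Real.sqrt_pos.mpr (by linarith)
  set α : ℝ := 1 / (s * (s + 1)) with hα
  have hWs : W = s ^ 2 - 1 := by linarith
  have hα1 : 1 - α * W = 1 / s := by
    rw [hα, hWs]; field_simp; ring
  have hα2 : 2 * α - α ^ 2 * W = 1 / s ^ 2 := by
    rw [hα, hWs]; field_simp; ring
  have hWc : ∑ j, v j * conj (v j) = (W : ℂ) := by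
    rw [hW]; push_cast
    exact Finset.sum_congr rfl fun j _ => Complex.mul_conj' _
  let M : Matrix (Fin n) (Fin n) ℂ :=
    1 + Matrix.replicateCol Unit (fun j => -(α : ℂ) * conj (v j)) * Matrix.replicateRow Unit v
  have hdetM : M.det = ((1 / s : ℝ) : ℂ) := by
    rw [Matrix.det_one_add_replicateCol_mul_replicateRow, ← hα1]
    push_cast
    rw [← hWc]
    simp only [dotProduct]
    rw [Finset.mul_sum, sub_eq_add_neg, ← Finset.sum_neg_distrib]
    congr 1
    refine Finset.sum_congr rfl fun j _ => ?_
    ring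
  let T : (Fin n → ℂ) →ₗ[ℂ] (Fin n → ℂ) := Matrix.toLin' M
  let TR : (Fin n → ℂ) →ₗ[ℝ] (Fin n → ℂ) := T.restrictScalars ℝ
  have hT : ∀ c j, TR c j = c j - α * (∑ k, c k * v k) * conj (v j) := by
    intro c j
    simp only [TR, T, LinearMap.restrictScalars_apply, Matrix.toLin'_apply, M, Matrix.add_mulVec,
      Matrix.one_mulVec, Pi.add_apply]
    rw [sub_eq_add_neg]
    congr 1
    simp only [Matrix.mulVec, dotProduct, Matrix.mul_apply, Matrix.replicateCol_apply,
      Matrix.replicateRow_apply, Finset.univ_unique, Finset.sum_const, Finset.card_singleton,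
      one_smul]
    rw [Finset.mul_sum, Finset.sum_mul, ← Finset.sum_neg_distrib]
    refine Finset.sum_congr rfl fun k _ => ?_
    ring
  have hdetT : LinearMap.det TR = 1 / s ^ 2 := by
    simp only [TR]
    rw [LinearMap.det_restrictScalars]
    simp only [T]
    rw [LinearMap.det_toLin', hdetM, Algebra.norm_complex_apply, Complex.normSq_ofReal]
    field_simp
  have hdet0 : LinearMap.det TR ≠ 0 := by rw [hdetT]; positivity
  have hmap := Measure.map_linearMap_addHaar_eq_smul_addHaar
    (volume : Measure (Fin n → ℂ)) hdet0
  let e := (LinearEquiv.ofIsUnitDet (f := TR) (v := Module.finBasis ℝ (Fin n → ℂ))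
    (v' := Module.finBasis ℝ (Fin n → ℂ))
    (by rw [LinearMap.det_toMatrix]; exact isUnit_iff_ne_zero.mpr hdet0)).toContinuousLinearEquiv
  have he : ∀ c, e c = TR c := fun c => rfl
  let G : (Fin n → ℂ) → ℂ := fun c => (∑ j, c j * a j) * conj (∑ j, c j * b j) *
        ((Real.exp (-(‖∑ j, c j * v j‖ ^ 2 + ∑ i, ‖c i‖ ^ 2)) : ℝ) : ℂ)
  set ma := ∑ j, a j * conj (v j) with hma
  set mb := ∑ j, b j * conj (v j) with hmb
  let a' : Fin n → ℂ := fun j => a j - α * ma * v j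
  let b' : Fin n → ℂ := fun j => b j - α * mb * v j
  have hlin : ∀ (u : Fin n → ℂ) c, ∑ j, TR c j * u j =
      ∑ j, c j * (u j - α * (∑ k, u k * conj (v k)) * v j) := by
    intro u c
    simp only [hT, sub_mul, mul_sub, Finset.sum_sub_distrib]
    congr 1
    have e1 : ∑ x, α * (∑ k, c k * v k) * conj (v x) * u x =
        α * (∑ k, c k * v k) * ∑ k, u k * conj (v k) := by
      generalize (∑ k, c k * v k) = L
      rw [Finset.mul_sum]
      exact Finset.sum_congr rfl fun k _ => by ring
    have e2 : ∑ x, c x * (α * (∑ k, u k * conj (v k)) * v x) =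
        α * (∑ k, u k * conj (v k)) * (∑ k, c k * v k) := by
      generalize (∑ k, u k * conj (v k)) = L
      rw [Finset.mul_sum]
      exact Finset.sum_congr rfl fun k _ => by ring
    rw [e1, e2]; ring
  have hvlin : ∀ c, ∑ j, TR c j * v j = ((1 / s : ℝ) : ℂ) * ∑ j, c j * v j := by
    intro c
    rw [hlin v c, hWc, ← hα1, Finset.mul_sum]
    push_cast
    exact Finset.sum_congr rfl fun k _ => by ring
  have hQ : ∀ c, ‖∑ j, TR c j * v j‖ ^ 2 + ∑ i, ‖TR c i‖ ^ 2 = ∑ i, ‖c i‖ ^ 2 := by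
    intro c
    have : ((‖∑ j, TR c j * v j‖ ^ 2 + ∑ i, ‖TR c i‖ ^ 2 : ℝ) : ℂ) =
        ((∑ i, ‖c i‖ ^ 2 : ℝ) : ℂ) := by
      set L := ∑ j, c j * v j with hL
      rw [hvlin, norm_mul, mul_pow, Complex.norm_real, Real.norm_of_nonneg (by positivity)]
      push_cast
      simp_rw [← Complex.mul_conj']
      rw [← hL]
      have e1 : ∑ i, TR c i * conj (TR c i) = ∑ i, c i * conj (c i) -
          α * L * conj L - α * conj L * L + α ^ 2 * L * conj L * W := by
        have : ∀ i, TR c i * conj (TR c i) = c i * conj (c i) - α * conj L * (c i * v i) -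
            α * L * conj (c i * v i) + α ^ 2 * L * conj L * (v i * conj (v i)) := by
          intro i
          rw [hT, ← hL]
          simp only [map_sub, map_mul, Complex.conj_conj, Complex.conj_ofReal]
          ring
        simp_rw [this]
        rw [Finset.sum_add_distrib, Finset.sum_sub_distrib, Finset.sum_sub_distrib,
          ← Finset.mul_sum, ← Finset.mul_sum, ← Finset.mul_sum, hWc, ← map_sum, ← hL]
        ring
      rw [e1]
      have h2 : (2 * (α : ℂ) - (α : ℂ) ^ 2 * W) = (1 / (s : ℂ)) ^ 2 := by
        have := congrArg (fun x : ℝ => (x : ℂ)) hα2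
        push_cast at this
        rw [this]; ring
      linear_combination (-L * conj L) * h2
    exact_mod_cast this
  have hcomp : ∀ c, G (TR c) = (∑ j, c j * a' j) * conj (∑ j, c j * b' j) *
      ((Real.exp (-∑ i, ‖c i‖ ^ 2) : ℝ) : ℂ) := by
    intro c
    simp only [G]
    rw [hQ, hlin a c, hlin b c]
  obtain ⟨hI, hE⟩ := kush_g3 n a' b'
  have hmap' : Measure.map e volume = ENNReal.ofReal (s ^ 2) • (volume : Measure (Fin n → ℂ)) := by
    have h1 : (e : (Fin n → ℂ) → (Fin n → ℂ)) = TR := funext he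
    rw [h1, hmap, hdetT]
    congr 2
    rw [one_div, inv_inv, abs_of_pos (by positivity)]
  have hce : (fun c => G (e c)) = fun c => (∑ j, c j * a' j) * conj (∑ j, c j * b' j) *
      ((Real.exp (-∑ i, ‖c i‖ ^ 2) : ℝ) : ℂ) := funext fun c => by rw [he, hcomp]
  have hemb : MeasurableEmbedding e := e.toHomeomorph.measurableEmbedding
  have hIG : Integrable G := by
    have h1 : Integrable G (Measure.map e volume) := by
      rw [hemb.integrable_map_iff]
      change Integrable (fun c => G (e c))
      rw [hce]; exact hI
    rw [hmap'] at h1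
    rwa [integrable_smul_measure (by positivity) ENNReal.ofReal_ne_top] at h1
  refine ⟨hIG, ?_⟩
  have h1 : ∫ c, G c ∂(Measure.map e volume) = (Real.pi : ℂ) ^ n * ∑ j, a' j * conj (b' j) := by
    rw [hemb.integral_map, ← hE, hce]
  rw [hmap', integral_smul_measure, ENNReal.toReal_ofReal (by positivity)] at h1
  have hsc : (s : ℂ) ^ 2 = 1 + W := by exact_mod_cast congrArg (fun x : ℝ => (x : ℂ)) hs2
  have hsc0 : (s : ℂ) ≠ 0 := by exact_mod_cast hs0.ne'
  have h3 : ∑ j, a' j * conj (b' j) = (∑ j, a j * conj (b j)) - ma * conj mb / (1 + W) := by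
    have : ∀ j, a' j * conj (b' j) = a j * conj (b j) - α * conj mb * (a j * conj (v j)) -
        α * ma * conj (b j * conj (v j)) + α ^ 2 * ma * conj mb * (v j * conj (v j)) := by
      intro j
      simp only [a', b', map_sub, map_mul, Complex.conj_conj, Complex.conj_ofReal]
      ring
    simp_rw [this]
    rw [Finset.sum_add_distrib, Finset.sum_sub_distrib, Finset.sum_sub_distrib,
      ← Finset.mul_sum, ← Finset.mul_sum, ← Finset.mul_sum, hWc, ← map_sum, ← hma, ← hmb]
    have h2 : (2 * (α : ℂ) - (α : ℂ) ^ 2 * W) = 1 / (1 + W) := by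
      have := congrArg (fun x : ℝ => (x : ℂ)) hα2
      push_cast at this
      rw [this, hsc]
    rw [div_eq_mul_one_div, ← h2]
    ring
  rw [h3] at h1
  change ∫ c, G c = _
  rw [Complex.real_smul] at h1
  push_cast at h1
  rw [hsc] at h1
  have h10 : (1 + W : ℂ) ≠ 0 := by rw [← hsc]; positivity
  have : ∫ c, G c = (1 + W : ℂ)⁻¹ * ((1 + W) * ∫ c, G c) := by field_simp
  rw [this, h1]
  field_simp

/-- The covariance matrix. -/
noncomputable def kushCov {d n : ℕ} (w : Fin n → ℝ) (p : Fin n → Fin d → ℝ) : Matrix (Fin d) (Fin d) ℝ :=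
  Matrix.of fun l m => (∑ j, w j * (p j l * p j m)) / (1 + ∑ j, w j) -
    (∑ j, w j * p j l) * (∑ j, w j * p j m) / (1 + ∑ j, w j) ^ 2

lemma kush_detsum {d : ℕ} (A : Matrix (Fin d) (Fin d) ℂ) :
    ∑ τ : Equiv.Perm (Fin d), ∑ σ : Equiv.Perm (Fin d),
      (((Equiv.Perm.sign σ : ℤ) : ℂ) * ((Equiv.Perm.sign τ : ℤ) : ℂ)) * ∏ i, A (σ i) (τ i)
      = d.factorial * A.det := by
  have h : ∀ τ : Equiv.Perm (Fin d), ∑ σ : Equiv.Perm (Fin d),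
      (((Equiv.Perm.sign σ : ℤ) : ℂ) * ((Equiv.Perm.sign τ : ℤ) : ℂ)) * ∏ i, A (σ i) (τ i)
      = A.det := by
    intro τ
    have h1 := Matrix.det_permute' τ A
    rw [Matrix.det_apply'] at h1
    simp only [Matrix.submatrix_apply, id] at h1
    have h2 : (((Equiv.Perm.sign τ : ℤ) : ℂ) * ((Equiv.Perm.sign τ : ℤ) : ℂ)) = 1 := by
      rw [← Int.cast_mul]
      have : (Equiv.Perm.sign τ : ℤ) * (Equiv.Perm.sign τ : ℤ) = 1 := by
        rw [← Units.val_mul, Int.units_mul_self]; rfl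
      rw [this]; simp
    calc _ = ((Equiv.Perm.sign τ : ℤ) : ℂ) *
          ∑ σ : Equiv.Perm (Fin d), ((Equiv.Perm.sign σ : ℤ) : ℂ) * ∏ i, A (σ i) (τ i) := by
          rw [Finset.mul_sum]
          exact Finset.sum_congr rfl fun σ _ => by ring
      _ = _ := by
          rw [h1, ← mul_assoc, h2, one_mul]
  simp_rw [h]
  simp [Fintype.card_perm]

open ComplexConjugate in
lemma kush_g5 {d n : ℕ} (v : Fin n → ℂ) (p : Fin n → Fin d → ℝ) :
    0 ≤ (kushCov (fun j => ‖v j‖ ^ 2) p).det ∧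
    ∫⁻ C : Fin d → Fin n → ℂ, ENNReal.ofReal
      (‖(Matrix.of fun i l => ∑ j, C i j * (v j * (p j l : ℂ)) : Matrix (Fin d) (Fin d) ℂ).det‖ ^ 2 *
        Real.exp (-∑ i, (‖∑ j, C i j * v j‖ ^ 2 + ∑ j, ‖C i j‖ ^ 2))) =
    ENNReal.ofReal ((Real.pi ^ n) ^ d * (d.factorial * (kushCov (fun j => ‖v j‖ ^ 2) p).det)) := by
  set w : Fin n → ℝ := fun j => ‖v j‖ ^ 2 with hw
  let f : (Fin d → Fin n → ℂ) → ℝ := fun C =>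
      (‖(Matrix.of fun i l => ∑ j, C i j * (v j * (p j l : ℂ)) : Matrix (Fin d) (Fin d) ℂ).det‖ ^ 2 *
        Real.exp (-∑ i, (‖∑ j, C i j * v j‖ ^ 2 + ∑ j, ‖C i j‖ ^ 2)))
  let R : Fin d → Fin d → (Fin n → ℂ) → ℂ := fun l m c =>
      (∑ j, c j * (v j * (p j l : ℂ))) * conj (∑ j, c j * (v j * (p j m : ℂ))) *
        ((Real.exp (-(‖∑ j, c j * v j‖ ^ 2 + ∑ i, ‖c i‖ ^ 2)) : ℝ) : ℂ)
  have hR : ∀ l m, Integrable (R l m) ∧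
      ∫ c, R l m c = (Real.pi : ℂ) ^ n * ((kushCov w p l m : ℝ) : ℂ) := by
    intro l m
    obtain ⟨h1, h2⟩ := kush_g4 n v (fun j => v j * (p j l : ℂ)) (fun j => v j * (p j m : ℂ))
      (∑ j, w j) rfl
    refine ⟨h1, ?_⟩
    simp only [R]
    rw [h2]
    congr 1
    simp only [kushCov, Matrix.of_apply]
    push_cast
    have e : ∀ j, ((w j : ℝ) : ℂ) = v j * conj (v j) := fun j => by
      rw [Complex.mul_conj']; simp [w]
    simp only [e, map_sum, map_mul, Complex.conj_conj, Complex.conj_ofReal]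
    congr 2
    · exact Finset.sum_congr rfl fun j _ => by ring
    · congr 1
      · exact Finset.sum_congr rfl fun j _ => by ring
      · exact Finset.sum_congr rfl fun j _ => by ring
  have hexp : ∀ C, ((f C : ℝ) : ℂ) = ∑ τ : Equiv.Perm (Fin d), ∑ σ : Equiv.Perm (Fin d),
      (((Equiv.Perm.sign σ : ℤ) : ℂ) * ((Equiv.Perm.sign τ : ℤ) : ℂ)) *
        ∏ i, R (σ i) (τ i) (C i) := by
    intro C
    simp only [f]
    push_cast
    rw [← Complex.mul_conj', ← Matrix.det_transpose, Matrix.det_apply', map_sum, Finset.sum_mul_sum,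
      Finset.sum_comm, Finset.sum_mul]
    refine Finset.sum_congr rfl fun τ _ => ?_
    rw [Finset.sum_mul]
    refine Finset.sum_congr rfl fun σ _ => ?_
    simp only [R, Finset.prod_mul_distrib, Matrix.transpose_apply, Matrix.of_apply, map_mul,
      map_prod]
    rw [← Complex.ofReal_prod, ← Real.exp_sum, Finset.sum_neg_distrib]
    simp only [map_intCast]
    push_cast
    ring
  have hIp : ∀ σ τ : Equiv.Perm (Fin d), Integrable fun C : Fin d → Fin n → ℂ =>
      (((Equiv.Perm.sign σ : ℤ) : ℂ) * ((Equiv.Perm.sign τ : ℤ) : ℂ)) *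
        ∏ i, R (σ i) (τ i) (C i) := fun σ τ =>
    (Integrable.fintype_prod fun i => (hR (σ i) (τ i)).1).const_mul _
  have hIc : Integrable fun C => ((f C : ℝ) : ℂ) := by
    rw [funext hexp]
    exact integrable_finsetSum _ fun τ _ => integrable_finsetSum _ fun σ _ => hIp σ τ
  have hEc : ∫ C, ((f C : ℝ) : ℂ) =
      (((Real.pi ^ n) ^ d * (d.factorial * (kushCov w p).det) : ℝ) : ℂ) := by
    rw [funext hexp, integral_finsetSum _ fun τ _ => integrable_finsetSum _ fun σ _ => hIp σ τ]
    have h1 : ∀ τ : Equiv.Perm (Fin d), ∫ C : Fin d → Fin n → ℂ, ∑ σ : Equiv.Perm (Fin d),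
      (((Equiv.Perm.sign σ : ℤ) : ℂ) * ((Equiv.Perm.sign τ : ℤ) : ℂ)) *
        ∏ i, R (σ i) (τ i) (C i) = ((Real.pi : ℂ) ^ n) ^ d * ∑ σ : Equiv.Perm (Fin d),
      (((Equiv.Perm.sign σ : ℤ) : ℂ) * ((Equiv.Perm.sign τ : ℤ) : ℂ)) *
        ∏ i, ((kushCov w p).map (fun x : ℝ => (x : ℂ))) (σ i) (τ i) := by
      intro τ
      rw [integral_finsetSum _ fun σ _ => hIp σ τ, Finset.mul_sum]
      refine Finset.sum_congr rfl fun σ _ => ?_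
      rw [integral_const_mul, integral_fintype_prod_volume_eq_prod]
      simp_rw [(hR _ _).2]
      rw [Finset.prod_mul_distrib]
      simp only [Finset.prod_const, Finset.card_univ, Fintype.card_fin, Matrix.map_apply]
      ring
    simp_rw [h1]
    rw [← Finset.mul_sum, kush_detsum]
    have h2 : ((kushCov w p).map (fun x : ℝ => (x : ℂ))).det = (((kushCov w p).det : ℝ) : ℂ) :=
      (RingHom.map_det Complex.ofRealHom (kushCov w p)).symm
    rw [h2]
    push_cast
    ring
  have hf0 : ∀ C, 0 ≤ f C := fun C => by simp only [f]; positivity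
  have hI : Integrable f := by
    have := hIc.re
    simpa using this
  have hE : ∫ C, f C = (Real.pi ^ n) ^ d * (d.factorial * (kushCov w p).det) := by
    rw [integral_complex_ofReal] at hEc
    exact_mod_cast hEc
  refine ⟨?_, ?_⟩
  · have h1 : 0 ≤ ∫ C, f C := integral_nonneg hf0
    rw [hE, ← mul_assoc] at h1
    have h2 : 0 < (Real.pi ^ n) ^ d * (d.factorial : ℝ) := by positivity
    exact nonneg_of_mul_nonneg_right h1 h2
  · rw [← hE, ofReal_integral_eq_lintegral_ofReal hI (Filter.Eventually.of_forall hf0)]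

/-- The exponential weights. -/
noncomputable def kushW {d n : ℕ} (p : Fin n → Fin d → ℝ) (x : Fin d → ℝ) (j : Fin n) : ℝ :=
  Real.exp (2 * ∑ l, p j l * x l)

/-- The moment map. -/
noncomputable def kushMu {d n : ℕ} (p : Fin n → Fin d → ℝ) (x : Fin d → ℝ) : Fin d → ℝ :=
  fun l => (∑ j, kushW p x j * p j l) / (1 + ∑ j, kushW p x j)

lemma kush_W_pos {d n : ℕ} (p : Fin n → Fin d → ℝ) (x : Fin d → ℝ) (j : Fin n) :
    0 < kushW p x j := Real.exp_pos _

lemma kush_D_pos {d n : ℕ} (p : Fin n → Fin d → ℝ) (x : Fin d → ℝ) :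
    0 < 1 + ∑ j, kushW p x j := by
  have : 0 ≤ ∑ j, kushW p x j := Finset.sum_nonneg fun j _ => (kush_W_pos p x j).le
  linarith

lemma kush_cov_mulVec {d n : ℕ} (w : Fin n → ℝ) (p : Fin n → Fin d → ℝ) (h : Fin d → ℝ)
    (l : Fin d) : (kushCov w p).mulVec h l =
      (∑ j, w j * (p j l * ∑ m, p j m * h m)) / (1 + ∑ j, w j) -
        (∑ j, w j * p j l) * (∑ j, w j * ∑ m, p j m * h m) / (1 + ∑ j, w j) ^ 2 := by
  simp only [Matrix.mulVec, dotProduct, kushCov, Matrix.of_apply, sub_mul, Finset.sum_sub_distrib]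
  congr 1
  · simp_rw [div_mul_eq_mul_div]
    rw [← Finset.sum_div]
    congr 1
    simp_rw [Finset.sum_mul, Finset.mul_sum]
    rw [Finset.sum_comm]
    exact Finset.sum_congr rfl fun j _ => Finset.sum_congr rfl fun m _ => by ring
  · simp_rw [div_mul_eq_mul_div]
    rw [← Finset.sum_div]
    congr 1
    have : ∑ j, w j * ∑ m, p j m * h m = ∑ m, (∑ j, w j * p j m) * h m := by
      simp_rw [Finset.sum_mul, Finset.mul_sum]
      rw [Finset.sum_comm]
      exact Finset.sum_congr rfl fun j _ => Finset.sum_congr rfl fun m _ => by ring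
    rw [this, Finset.mul_sum]
    exact Finset.sum_congr rfl fun j _ => by ring

lemma kush_cov_quad {d n : ℕ} (w : Fin n → ℝ) (p : Fin n → Fin d → ℝ) (h : Fin d → ℝ)
    (hw : ∀ j, 0 < w j) (hh : ∃ j, ∑ m, p j m * h m ≠ 0) :
    0 < ∑ l, h l * (kushCov w p).mulVec h l := by
  set q : Fin n → ℝ := fun j => ∑ m, p j m * h m with hq
  have hD : 0 < 1 + ∑ j, w j := by
    have : 0 ≤ ∑ j, w j := Finset.sum_nonneg fun j _ => (hw j).le
    linarith
  have e : ∑ l, h l * (kushCov w p).mulVec h l =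
      (∑ j, w j * q j ^ 2) / (1 + ∑ j, w j) - (∑ j, w j * q j) ^ 2 / (1 + ∑ j, w j) ^ 2 := by
    simp_rw [kush_cov_mulVec, mul_sub]
    rw [Finset.sum_sub_distrib]
    congr 1
    · simp_rw [← mul_div_assoc]
      rw [← Finset.sum_div]
      congr 1
      simp_rw [Finset.mul_sum]
      rw [Finset.sum_comm]
      refine Finset.sum_congr rfl fun j _ => ?_
      have : q j ^ 2 = (∑ m, p j m * h m) * q j := by rw [hq]; ring
      rw [this, Finset.sum_mul, Finset.mul_sum]
      refine Finset.sum_congr rfl fun m _ => ?_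
      rw [← Finset.mul_sum, ← Finset.mul_sum, ← Finset.mul_sum]
      change _ * (_ * (_ * q j)) = _
      ring
    · simp_rw [← mul_div_assoc]
      rw [← Finset.sum_div]
      congr 1
      change ∑ x, h x * ((∑ j, w j * p j x) * (∑ j, w j * q j)) = _
      simp_rw [← mul_assoc]
      rw [← Finset.sum_mul, sq]
      congr 1
      simp_rw [hq, Finset.mul_sum]
      rw [Finset.sum_comm]
      exact Finset.sum_congr rfl fun j _ => Finset.sum_congr rfl fun m _ => by ring
  rw [e]
  have hpos : 0 < ∑ j, w j * q j ^ 2 := by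
    obtain ⟨j, hj⟩ := hh
    refine Finset.sum_pos' (fun i _ => mul_nonneg (hw i).le (sq_nonneg _)) ⟨j, Finset.mem_univ j, ?_⟩
    exact mul_pos (hw j) (by positivity)
  have hcs : (∑ j, w j * q j) ^ 2 ≤ (∑ j, w j) * ∑ j, w j * q j ^ 2 := by
    apply Finset.sum_sq_le_sum_mul_sum_of_sq_le_mul
    · intro i _; exact (hw i).le
    · intro i _; exact mul_nonneg (hw i).le (sq_nonneg _)
    · intro i _; exact le_of_eq (by ring)
  have : (∑ j, w j * q j ^ 2) / (1 + ∑ j, w j) - (∑ j, w j * q j) ^ 2 / (1 + ∑ j, w j) ^ 2 =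
      ((1 + ∑ j, w j) * (∑ j, w j * q j ^ 2) - (∑ j, w j * q j) ^ 2) / (1 + ∑ j, w j) ^ 2 := by
    field_simp
  rw [this]
  apply div_pos _ (by positivity)
  nlinarith

lemma kush_mu_deriv {d n : ℕ} (p : Fin n → Fin d → ℝ) (x : Fin d → ℝ) :
    HasFDerivAt (kushMu p)
      (LinearMap.toContinuousLinearMap (Matrix.toLin' ((2 : ℝ) • kushCov (kushW p x) p))) x := by
  have hl : ∀ j, HasFDerivAt (fun x : Fin d → ℝ => 2 * ∑ l, p j l * x l)
      ((2 : ℝ) • ∑ l, p j l • (ContinuousLinearMap.proj l : (Fin d → ℝ) →L[ℝ] ℝ)) x := by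
    intro j
    refine HasFDerivAt.const_mul ?_ 2
    refine HasFDerivAt.fun_sum fun l _ => ?_
    exact (hasFDerivAt_apply l x).const_mul (p j l)
  have hW : ∀ j, HasFDerivAt (fun x => kushW p x j) (kushW p x j •
      ((2 : ℝ) • ∑ l, p j l • (ContinuousLinearMap.proj l : (Fin d → ℝ) →L[ℝ] ℝ))) x :=
    fun j => (hl j).exp
  rw [hasFDerivAt_pi']
  intro l
  have hN := HasFDerivAt.fun_sum (u := Finset.univ) fun j _ => (hW j).mul_const (p j l)
  have hD := (HasFDerivAt.fun_sum (u := Finset.univ) fun j _ => hW j).const_add (1 : ℝ)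
  have hDi := (hasDerivAt_inv (kush_D_pos p x).ne').comp_hasFDerivAt x hD
  have := hN.mul hDi
  refine (this.congr_fderiv ?_)
  ext h
  have hD0 := (kush_D_pos p x).ne'
  simp only [_root_.add_apply, _root_.smul_apply,
    _root_.sum_apply, ContinuousLinearMap.proj_apply, smul_eq_mul,
    ContinuousLinearMap.comp_apply, LinearMap.coe_toContinuousLinearMap', Matrix.toLin'_apply,
    Matrix.smul_mulVec, Pi.smul_apply, kush_cov_mulVec, Function.comp]
  have e1 : ∑ j, kushW p x j * (2 * ∑ l, p j l * h l) =
    2 * ∑ j, kushW p x j * ∑ l, p j l * h l := by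
    rw [Finset.mul_sum]
    exact Finset.sum_congr rfl fun j _ => by ring
  have e2 : ∑ j, p j l * (kushW p x j * (2 * ∑ l, p j l * h l)) =
    2 * ∑ j, kushW p x j * (p j l * ∑ l, p j l * h l) := by
    rw [Finset.mul_sum]
    exact Finset.sum_congr rfl fun j _ => by ring
  rw [e1, e2]
  field_simp
  ring


lemma kush_mu_inj {d n : ℕ} (p : Fin n → Fin d → ℝ)
    (hp : ∀ h : Fin d → ℝ, h ≠ 0 → ∃ j, ∑ m, p j m * h m ≠ 0) :
    Function.Injective (kushMu p) := by
  intro x y hxy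
  by_contra hne
  set h := y - x with hh
  have hh0 : h ≠ 0 := fun h0 => hne (sub_eq_zero.mp (hh ▸ h0)).symm
  let φ : ℝ → ℝ := fun s => ∑ l, h l * kushMu p (x + s • h) l
  have hφ : ∀ s, HasDerivAt φ
      (2 * ∑ l, h l * (kushCov (kushW p (x + s • h)) p).mulVec h l) s := by
    intro s
    have h1 : HasDerivAt (fun s : ℝ => x + s • h) h s := by
      have := ((hasDerivAt_id s).smul_const h).const_add x
      simpa using this
    have h2 := (kush_mu_deriv p (x + s • h)).comp_hasDerivAt s h1
    have h3 := fun l => (hasDerivAt_pi.mp h2) l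
    have h4 := HasDerivAt.fun_sum (u := Finset.univ) fun l _ => (h3 l).const_mul (h l)
    refine h4.congr_deriv ?_
    rw [Finset.mul_sum]
    refine Finset.sum_congr rfl fun l _ => ?_
    simp only [LinearMap.coe_toContinuousLinearMap', Matrix.toLin'_apply,
      Matrix.smul_mulVec, Pi.smul_apply, smul_eq_mul]
    ring
  have hmono : StrictMono φ := by
    refine strictMono_of_hasDerivAt_pos hφ fun s => ?_
    have := kush_cov_quad (kushW p (x + s • h)) p h (kush_W_pos p _) (hp h hh0)
    linarith
  have := hmono (zero_lt_one)
  simp [φ, hh, hxy] at this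

lemma kush_mu_mem {d n : ℕ} (p : Fin n → Fin d → ℝ) (x : Fin d → ℝ) :
    kushMu p x ∈ convexHull ℝ (Set.range p ∪ {0}) := by
  let a : Option (Fin n) → Fin d → ℝ := fun o => o.elim 0 p
  let w : Option (Fin n) → ℝ := fun o => (o.elim 1 (kushW p x)) / (1 + ∑ j, kushW p x j)
  have hD := kush_D_pos p x
  have h := (convex_convexHull ℝ (Set.range p ∪ {0})).sum_mem (t := Finset.univ) (w := w) (z := a)
    (by
      rintro (_ | j) _
      · simp only [w, Option.elim]; positivity
      · simp only [w, Option.elim]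
        exact div_nonneg (kush_W_pos p x j).le hD.le)
    (by
      simp only [w]
      rw [← Finset.sum_div, Fintype.sum_option]
      exact div_self hD.ne')
    (by
      rintro (_ | j) _
      · exact subset_convexHull _ _ (Or.inr rfl)
      · exact subset_convexHull _ _ (Or.inl ⟨j, rfl⟩))
  convert h using 1
  ext l
  simp only [kushMu, Finset.sum_apply, Pi.smul_apply, smul_eq_mul, Fintype.sum_option, w, a,
    Option.elim, Pi.zero_apply, mul_zero, zero_add]
  rw [Finset.sum_div]
  exact Finset.sum_congr rfl fun j _ => by ring

lemma kush_mu_surj {d n : ℕ} (p : Fin n → Fin d → ℝ) (y : Fin d → ℝ)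
    (hy : y ∈ interior (convexHull ℝ (Set.range p ∪ {0}))) : y ∈ Set.range (kushMu p) := by
  let a : Option (Fin n) → Fin d → ℝ := fun o => o.elim 0 p
  have ha : Set.range p ∪ {0} = Set.range a := by
    ext z
    constructor
    · rintro (⟨j, rfl⟩ | rfl)
      · exact ⟨some j, rfl⟩
      · exact ⟨none, rfl⟩
    · rintro ⟨_ | j, rfl⟩
      · exact Or.inr rfl
      · exact Or.inl ⟨j, rfl⟩
  rw [ha] at hy
  let G : (Fin d → ℝ) → ℝ := fun x => ∑ o, Real.exp (2 * ∑ l, (a o l - y l) * x l)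
  have hGc : Continuous G := by fun_prop
  obtain ⟨ε, hε, hball⟩ := Metric.isOpen_iff.mp isOpen_interior y hy
  have hlow : ∀ x, ε * ‖x‖ ≤ G x := by
    intro x
    let y' : Fin d → ℝ := fun l => y l + ε / 2 * SignType.sign (x l)
    have hy' : y' ∈ convexHull ℝ (Set.range a) := by
      apply interior_subset
      apply hball
      rw [Metric.mem_ball, dist_pi_lt_iff hε]
      intro l
      simp only [y', Real.dist_eq, add_sub_cancel_left, abs_mul]
      rw [abs_of_pos (by positivity)]
      have : |((SignType.sign (x l) : SignType) : ℝ)| ≤ 1 := by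
        rcases lt_trichotomy (x l) 0 with h | h | h <;> simp [h]
      nlinarith
    have hex : ∃ o, ∑ l, y' l * x l ≤ ∑ l, a o l * x l := by
      by_contra hcon
      push Not at hcon
      have hconv : Convex ℝ {z : Fin d → ℝ | ∑ l, z l * x l < ∑ l, y' l * x l} := by
        apply convex_halfSpace_lt
        constructor
        · intro u v; simp [add_mul, Finset.sum_add_distrib]
        · intro c u; simp [Finset.mul_sum, mul_assoc]
      have := convexHull_min (s := Set.range a) (by rintro _ ⟨o, rfl⟩; exact hcon o) hconv hy'
      rw [Set.mem_ofPred_eq] at this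
      exact lt_irrefl _ this
    obtain ⟨o, ho⟩ := hex
    have h1 : ε / 2 * ‖x‖ ≤ ∑ l, (a o l - y l) * x l := by
      have e : ∑ l, y' l * x l = ∑ l, y l * x l + ε / 2 * ∑ l, |x l| := by
        rw [Finset.mul_sum, ← Finset.sum_add_distrib]
        refine Finset.sum_congr rfl fun l _ => ?_
        simp only [y']
        rw [add_mul, mul_assoc, sign_mul_self]
      have hn : ‖x‖ ≤ ∑ l, |x l| := by
        rw [pi_norm_le_iff_of_nonneg (Finset.sum_nonneg fun l _ => abs_nonneg _)]
        intro l
        exact Finset.single_le_sum (f := fun l => |x l|) (fun l _ => abs_nonneg _) (Finset.mem_univ l)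
      simp_rw [sub_mul]
      rw [Finset.sum_sub_distrib]
      have : ε / 2 * ‖x‖ ≤ ε / 2 * ∑ l, |x l| := by gcongr
      linarith
    have h2 : Real.exp (2 * ∑ l, (a o l - y l) * x l) ≤ G x :=
      Finset.single_le_sum (f := fun o => Real.exp (2 * ∑ l, (a o l - y l) * x l))
        (fun o _ => (Real.exp_pos _).le) (Finset.mem_univ o)
    have h3 := Real.add_one_le_exp (2 * ∑ l, (a o l - y l) * x l)
    linarith
  have hlim : Filter.Tendsto G (Filter.cocompact _) Filter.atTop := by
    refine Filter.tendsto_atTop_mono hlow ?_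
    exact (tendsto_norm_cocompact_atTop).const_mul_atTop hε
  obtain ⟨x, hx⟩ := hGc.exists_forall_le hlim
  refine ⟨x, ?_⟩
  ext l
  have hd : HasDerivAt (fun s : ℝ => G (x + s • Pi.single l 1))
      (∑ o, Real.exp (2 * ∑ l, (a o l - y l) * x l) * (2 * (a o l - y l))) 0 := by
    refine HasDerivAt.fun_sum fun o _ => ?_
    have h1 : HasDerivAt (fun s : ℝ => 2 * ∑ m, (a o m - y m) * (x + s • (Pi.single l (1 : ℝ) : Fin d → ℝ)) m)
        (2 * (a o l - y l)) 0 := by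
      have e : (fun s : ℝ => 2 * ∑ m, (a o m - y m) * (x + s • (Pi.single l (1 : ℝ) : Fin d → ℝ)) m) =
          fun s => 2 * ∑ m, (a o m - y m) * x m + s * (2 * (a o l - y l)) := by
        ext s
        simp only [Pi.add_apply, Pi.smul_apply, smul_eq_mul, mul_add, Finset.sum_add_distrib,
          Pi.single_apply, mul_ite, mul_one, mul_zero, Finset.sum_ite_eq',
          Finset.mem_univ, if_true]
        ring
      rw [e]
      have := ((hasDerivAt_id (0 : ℝ)).mul_const (2 * (a o l - y l))).const_add
        (2 * ∑ m, (a o m - y m) * x m)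
      simpa using this
    have := h1.exp
    simpa using this
  have hmin : IsLocalMin (fun s : ℝ => G (x + s • Pi.single l 1)) 0 := by
    refine Filter.Eventually.of_forall fun s => ?_
    simpa using hx (x + s • Pi.single l 1)
  have h0 := hmin.hasDerivAt_eq_zero hd
  have hE : ∀ o, Real.exp (2 * ∑ l, (a o l - y l) * x l) =
      Real.exp (-(2 * ∑ l, y l * x l)) * Real.exp (2 * ∑ l, a o l * x l) := by
    intro o
    rw [← Real.exp_add]
    congr 1
    simp_rw [sub_mul]
    rw [Finset.sum_sub_distrib]; ring
  have h1 : ∑ o, Real.exp (2 * ∑ l, a o l * x l) * (a o l - y l) = 0 := by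
    have e : ∑ o, Real.exp (2 * ∑ l, (a o l - y l) * x l) * (2 * (a o l - y l)) =
      (2 * Real.exp (-(2 * ∑ l, y l * x l))) *
        ∑ o, Real.exp (2 * ∑ l, a o l * x l) * (a o l - y l) := by
      rw [Finset.mul_sum]
      refine Finset.sum_congr rfl fun o _ => ?_
      rw [hE]; ring
    rw [e] at h0
    exact (mul_eq_zero.mp h0).resolve_left (by positivity)
  rw [Fintype.sum_option] at h1
  simp only [a, Option.elim, Pi.zero_apply, zero_mul, Finset.sum_const_zero, mul_zero,
    Real.exp_zero, zero_sub, one_mul] at h1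
  change -y l + ∑ j, kushW p x j * (p j l - y l) = 0 at h1
  simp_rw [mul_sub] at h1
  rw [Finset.sum_sub_distrib, ← Finset.sum_mul] at h1
  simp only [kushMu]
  rw [div_eq_iff (kush_D_pos p x).ne']
  linarith

lemma kush_vol {d n : ℕ} (p : Fin n → Fin d → ℝ) :
    ∫⁻ x : Fin d → ℝ, ENNReal.ofReal (2 ^ d * (kushCov (kushW p x) p).det) =
      volume (convexHull ℝ (Set.range p ∪ {0})) := by
  have hnn : ∀ x, 0 ≤ (kushCov (kushW p x) p).det := by
    intro x
    have := (kush_g5 (fun j => ((Real.sqrt (kushW p x j) : ℝ) : ℂ)) p).1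
    have e : (fun j => ‖((Real.sqrt (kushW p x j) : ℝ) : ℂ)‖ ^ 2) = kushW p x := by
      ext j
      rw [Complex.norm_real, Real.norm_of_nonneg (Real.sqrt_nonneg _),
        Real.sq_sqrt (kush_W_pos p x j).le]
    rwa [e] at this
  by_cases hp : ∀ h : Fin d → ℝ, h ≠ 0 → ∃ j, ∑ m, p j m * h m ≠ 0
  · have h1 := lintegral_abs_det_fderiv_eq_addHaar_image volume MeasurableSet.univ
      (fun x _ => (kush_mu_deriv p x).hasFDerivWithinAt) (kush_mu_inj p hp).injOn
    rw [Measure.restrict_univ, Set.image_univ] at h1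
    have h2 : ∀ x, |(LinearMap.toContinuousLinearMap
        (Matrix.toLin' ((2 : ℝ) • kushCov (kushW p x) p))).det| =
        2 ^ d * (kushCov (kushW p x) p).det := by
      intro x
      rw [LinearMap.det_toContinuousLinearMap, LinearMap.det_toLin', Matrix.det_smul]
      rw [Fintype.card_fin, abs_of_nonneg (mul_nonneg (by positivity) (hnn x))]
    simp_rw [h2] at h1
    rw [h1]
    apply le_antisymm
    · apply measure_mono
      rintro _ ⟨x, rfl⟩
      exact kush_mu_mem p x
    · have hfr := (convex_convexHull ℝ (Set.range p ∪ {0})).addHaar_frontier volume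
      calc volume (convexHull ℝ (Set.range p ∪ {0}))
          ≤ volume (interior (convexHull ℝ (Set.range p ∪ {0})) ∪
              frontier (convexHull ℝ (Set.range p ∪ {0}))) := by
            apply measure_mono
            rw [← closure_eq_interior_union_frontier]
            exact subset_closure
        _ ≤ volume (interior (convexHull ℝ (Set.range p ∪ {0}))) + 0 := by
            rw [← hfr]; exact measure_union_le _ _
        _ ≤ _ := by
            rw [add_zero]
            exact measure_mono fun y hy => kush_mu_surj p y hy
  · push Not at hp
    obtain ⟨h, hh0, hh⟩ := hp
    have hdet : ∀ x, (kushCov (kushW p x) p).det = 0 := by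
      intro x
      rw [← Matrix.exists_mulVec_eq_zero_iff]
      refine ⟨h, hh0, ?_⟩
      ext l
      rw [kush_cov_mulVec]
      simp [hh]
    simp_rw [hdet]
    simp only [mul_zero, ENNReal.ofReal_zero, lintegral_zero]
    symm
    let φ : (Fin d → ℝ) →ₗ[ℝ] ℝ := ∑ l, h l • LinearMap.proj l
    have hφ : ∀ z, φ z = ∑ l, z l * h l := by
      intro z
      simp [φ, mul_comm]
    have hker : LinearMap.ker φ ≠ ⊤ := by
      intro ht
      have h1 : h ∈ LinearMap.ker φ := by rw [ht]; trivial
      rw [LinearMap.mem_ker, hφ] at h1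
      apply hh0
      ext l
      have := (Finset.sum_eq_zero_iff_of_nonneg (fun l _ => mul_self_nonneg (h l))).mp h1 l
        (Finset.mem_univ l)
      simpa using this
    refine measure_mono_null ?_ (Measure.addHaar_submodule volume (LinearMap.ker φ) hker)
    apply convexHull_min
    · rintro z (⟨j, rfl⟩ | rfl)
      · change φ (p j) = 0
        rw [hφ, hh]
      · exact (LinearMap.ker φ).zero_mem
    · exact (LinearMap.ker φ).convex

/-- The system in logarithmic coordinates. -/
noncomputable def kushF {d n : ℕ} (p0 : Fin n → Fin d → ℤ) (C : Fin d → Fin n → ℂ)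
    (z : Fin d → ℂ) : Fin d → ℂ :=
  fun i => ∑ j, C i j * Complex.exp (∑ l, (p0 j l : ℂ) * z l)

/-- The fundamental strip. -/
def kushStrip (d : ℕ) : Set (Fin d → ℂ) := {z | ∀ l, (z l).im ∈ Set.Ioc (-Real.pi) Real.pi}

/-- Linear identification of the coefficient space. -/
def kushL (d n : ℕ) :
    ((Fin d → Fin n → ℂ) × (Fin d → ℂ)) ≃ₗ[ℝ] (Fin d × Fin (n + 1) → ℂ) where
  toFun x := fun ik => Fin.cons (α := fun _ => ℂ) (x.2 ik.1) (x.1 ik.1) ik.2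
  invFun c := (fun i j => c (i, j.succ), fun i => c (i, 0))
  map_add' x y := by
    ext ⟨i, k⟩
    refine Fin.cases ?_ (fun j => ?_) k <;> simp
  map_smul' r x := by
    ext ⟨i, k⟩
    refine Fin.cases ?_ (fun j => ?_) k <;> simp
  left_inv x := by
    ext <;> simp
  right_inv c := by
    ext ⟨i, k⟩
    refine Fin.cases ?_ (fun j => ?_) k <;> simp

lemma kush_encard {d n : ℕ} (p0 : Fin n → Fin d → ℤ) (C : Fin d → Fin n → ℂ) (c0 : Fin d → ℂ) :
    (kushStrip d ∩ kushF p0 C ⁻¹' {c0}).encard = (kushS p0 (kushL d n (C, c0))).encard := by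
  let E : (Fin d → ℂ) → (Fin d → ℂ) := fun z l => Complex.exp (z l)
  have hinj : Set.InjOn E (kushStrip d ∩ kushF p0 C ⁻¹' {c0}) := by
    rintro z ⟨hz, _⟩ z' ⟨hz', _⟩ h
    ext l
    exact Complex.exp_inj_of_neg_pi_lt_of_le_pi (hz l).1 (hz l).2 (hz' l).1 (hz' l).2
      (congrFun h l)
  have hprod : ∀ (z : Fin d → ℂ) j, ∏ l, E z l ^ p0 j l =
      Complex.exp (∑ l, (p0 j l : ℂ) * z l) := by
    intro z j
    rw [Complex.exp_sum]
    exact Finset.prod_congr rfl fun l _ => (Complex.exp_int_mul _ _).symm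
  have himg : E '' (kushStrip d ∩ kushF p0 C ⁻¹' {c0}) = kushS p0 (kushL d n (C, c0)) := by
    ext t
    constructor
    · rintro ⟨z, ⟨hz, hF⟩, rfl⟩
      refine ⟨fun i => Complex.exp_ne_zero _, fun i => ?_⟩
      simp_rw [hprod]
      exact congrFun hF i
    · rintro ⟨ht, hs⟩
      have hE : E (fun l => Complex.log (t l)) = t := by
        ext l; exact Complex.exp_log (ht l)
      refine ⟨fun l => Complex.log (t l), ⟨fun l => ⟨Complex.neg_pi_lt_log_im _,
        Complex.log_im_le_pi _⟩, ?_⟩, hE⟩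
      rw [Set.mem_preimage, Set.mem_singleton_iff]
      ext i
      simp only [kushF]
      simp_rw [← hprod, hE]
      exact hs i
  rw [← himg, hinj.encard_image]

lemma kush_F_deriv {d n : ℕ} (p0 : Fin n → Fin d → ℤ) (C : Fin d → Fin n → ℂ)
    (z : Fin d → ℂ) :
    HasFDerivAt (kushF p0 C) ((LinearMap.toContinuousLinearMap (Matrix.toLin'
      (Matrix.of fun i l => ∑ j, C i j * (Complex.exp (∑ l, (p0 j l : ℂ) * z l) *
        ((p0 j l : ℝ) : ℂ)) : Matrix (Fin d) (Fin d) ℂ))).restrictScalars ℝ) z := by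
  apply HasFDerivAt.restrictScalars
  have hl : ∀ j, HasFDerivAt (fun z : Fin d → ℂ => ∑ l, (p0 j l : ℂ) * z l)
      (∑ l, (p0 j l : ℂ) • (ContinuousLinearMap.proj l : (Fin d → ℂ) →L[ℂ] ℂ)) z := by
    intro j
    refine HasFDerivAt.fun_sum fun l _ => ?_
    exact (hasFDerivAt_apply l z).const_mul _
  rw [hasFDerivAt_pi']
  intro i
  have := HasFDerivAt.fun_sum (u := Finset.univ) fun j _ => ((hl j).cexp).const_mul (C i j)
  refine this.congr_fderiv ?_
  ext h
  simp only [_root_.smul_apply, _root_.sum_apply,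
    ContinuousLinearMap.proj_apply, smul_eq_mul,
    ContinuousLinearMap.comp_apply, LinearMap.coe_toContinuousLinearMap', Matrix.toLin'_apply,
    Matrix.mulVec, dotProduct, Matrix.of_apply, Finset.mul_sum, Finset.sum_mul]
  rw [Finset.sum_comm]
  refine Finset.sum_congr rfl fun l _ => Finset.sum_congr rfl fun j _ => ?_
  push_cast
  ring

lemma kush_F_det {d : ℕ} (M : Matrix (Fin d) (Fin d) ℂ) :
    |((LinearMap.toContinuousLinearMap (Matrix.toLin' M)).restrictScalars ℝ).det| =
      ‖M.det‖ ^ 2 := by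
  have : ((LinearMap.toContinuousLinearMap (Matrix.toLin' M)).restrictScalars ℝ).det =
      LinearMap.det ((Matrix.toLin' M).restrictScalars ℝ) := rfl
  rw [this, LinearMap.det_restrictScalars, LinearMap.det_toLin', Algebra.norm_complex_apply,
    Complex.normSq_eq_norm_sq, abs_of_nonneg (by positivity)]

lemma kush_strip_meas (d : ℕ) : MeasurableSet (kushStrip d) := by
  have : kushStrip d = ⋂ l, (fun z : Fin d → ℂ => (z l).im) ⁻¹' Set.Ioc (-Real.pi) Real.pi := by
    ext z; simp [kushStrip]
  rw [this]
  refine MeasurableSet.iInter fun l => measurableSet_Ioc.preimage ?_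
  fun_prop

lemma kush_fix {d n : ℕ} (p0 : Fin n → Fin d → ℤ) (C : Fin d → Fin n → ℂ) :
    ∫⁻ c0 : Fin d → ℂ, ((kushS p0 (kushL d n (C, c0))).encard : ℝ≥0∞) *
        ENNReal.ofReal (Real.exp (-∑ i, ‖c0 i‖ ^ 2)) =
      ∫⁻ z in kushStrip d, ENNReal.ofReal (‖(Matrix.of fun i l => ∑ j, C i j *
        (Complex.exp (∑ l, (p0 j l : ℂ) * z l) *
        ((p0 j l : ℝ) : ℂ)) : Matrix (Fin d) (Fin d) ℂ).det‖ ^ 2) *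
        ENNReal.ofReal (Real.exp (-∑ i, ‖kushF p0 C z i‖ ^ 2)) := by
  have h := kush_area (volume : Measure (Fin d → ℂ)) (kushF p0 C) _ (by
      unfold kushF
      fun_prop) (kush_F_deriv p0 C) (kushStrip d) (kush_strip_meas d)
    (fun c0 => ENNReal.ofReal (Real.exp (-∑ i, ‖c0 i‖ ^ 2))) (by fun_prop)
  simp_rw [kush_encard, kush_F_det] at h
  exact h

lemma kush_strip_int (d : ℕ) (f : (Fin d → ℝ) → ℝ≥0∞) (hf : Measurable f) :
    ∫⁻ z in kushStrip d, f (fun l => (z l).re) =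
      ENNReal.ofReal ((2 * Real.pi) ^ d) * ∫⁻ x, f x := by
  have h1 := volume_preserving_pi (fun _ : Fin d => Complex.volume_preserving_equiv_real_prod)
  have h2 := volume_measurePreserving_arrowProdEquivProdArrow ℝ ℝ (Fin d)
  have h3 := h2.comp h1
  set T : Set ((Fin d → ℝ) × (Fin d → ℝ)) :=
    Set.univ ×ˢ Set.pi Set.univ fun _ => Set.Ioc (-Real.pi) Real.pi with hT
  have hTm : MeasurableSet T :=
    MeasurableSet.univ.prod (MeasurableSet.univ_pi fun _ => measurableSet_Ioc)
  have h4 := h3.setLIntegral_comp_preimage hTm (f := fun q => f q.1) (hf.comp measurable_fst)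
  have h5 : (MeasurableEquiv.arrowProdEquivProdArrow ℝ ℝ (Fin d) ∘
      fun (a : Fin d → ℂ) i => Complex.measurableEquivRealProd (a i)) ⁻¹' T = kushStrip d := by
    ext z
    simp [T, kushStrip, MeasurableEquiv.arrowProdEquivProdArrow, Equiv.arrowProdEquivProdArrow]
  rw [h5] at h4
  refine Eq.trans h4 ?_
  rw [hT, Measure.volume_eq_prod, ← Measure.prod_restrict, Measure.restrict_univ, 
    lintegral_prod _ (by fun_prop)]
  simp only [lintegral_const, Measure.restrict_apply_univ]
  rw [lintegral_mul_const _ hf, mul_comm, volume_pi_pi]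
  congr 1
  simp only [Real.volume_Ioc, Finset.prod_const, Finset.card_univ, Fintype.card_fin]
  rw [ENNReal.ofReal_pow (by positivity)]
  congr 2
  ring


lemma kush_cov_cont {d n : ℕ} (p : Fin n → Fin d → ℝ) :
    Continuous fun x => (kushCov (kushW p x) p).det := by
  have hW : ∀ j, Continuous fun x => kushW p x j := by
    intro j; unfold kushW; fun_prop
  apply Continuous.matrix_det
  apply continuous_matrix
  intro l m
  simp only [kushCov, Matrix.of_apply]
  apply Continuous.sub
  · exact Continuous.div (by fun_prop) (by fun_prop) fun x => (kush_D_pos p x).ne'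
  · exact Continuous.div (by fun_prop) (by fun_prop) fun x => pow_ne_zero _ (kush_D_pos p x).ne'

lemma kush_total {d n : ℕ} (p0 : Fin n → Fin d → ℤ) :
    ∫⁻ C : Fin d → Fin n → ℂ, ENNReal.ofReal (Real.exp (-∑ i, ∑ j, ‖C i j‖ ^ 2)) *
      ∫⁻ c0 : Fin d → ℂ, ((kushS p0 (kushL d n (C, c0))).encard : ℝ≥0∞) *
        ENNReal.ofReal (Real.exp (-∑ i, ‖c0 i‖ ^ 2)) =
    ENNReal.ofReal ((Real.pi ^ n) ^ d) * ENNReal.ofReal (Real.pi ^ d) *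
      ((d.factorial : ℝ≥0∞) *
          volume (convexHull ℝ ((Set.range fun j => fun l => (p0 j l : ℝ)) ∪ {0}))) := by
  set p : Fin n → Fin d → ℝ := fun j l => (p0 j l : ℝ) with hp
  let v : (Fin d → ℂ) → Fin n → ℂ := fun z j => Complex.exp (∑ l, (p0 j l : ℂ) * z l)
  have hv : ∀ z, (fun j => ‖v z j‖ ^ 2) = kushW p (fun l => (z l).re) := by
    intro z
    ext j
    simp only [v, kushW, Complex.norm_exp]
    rw [← Real.exp_nat_mul]
    congr 1
    simp [p, Complex.re_sum]
  let Φ : (Fin d → Fin n → ℂ) → (Fin d → ℂ) → ℝ := fun C z =>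
    (‖(Matrix.of fun i l => ∑ j, C i j * (v z j * (p j l : ℂ)) : Matrix (Fin d) (Fin d) ℂ).det‖ ^ 2 *
        Real.exp (-∑ i, (‖∑ j, C i j * v z j‖ ^ 2 + ∑ j, ‖C i j‖ ^ 2)))
  have hΦ : Continuous (Function.uncurry Φ) := by
    have hvc : ∀ j, Continuous fun z => v z j := by
      intro j; simp only [v]; fun_prop
    simp only [Φ, Function.uncurry_def]
    apply Continuous.mul
    · apply Continuous.pow
      apply Continuous.norm
      apply Continuous.matrix_det
      apply continuous_matrix
      intro l m
      simp only [Matrix.of_apply]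
      fun_prop
    · fun_prop
  have h1 : ∀ C : Fin d → Fin n → ℂ, ENNReal.ofReal (Real.exp (-∑ i, ∑ j, ‖C i j‖ ^ 2)) *
      ∫⁻ c0 : Fin d → ℂ, ((kushS p0 (kushL d n (C, c0))).encard : ℝ≥0∞) *
        ENNReal.ofReal (Real.exp (-∑ i, ‖c0 i‖ ^ 2)) =
      ∫⁻ z in kushStrip d, ENNReal.ofReal (Φ C z) := by
    intro C
    rw [kush_fix, ← lintegral_const_mul' _ _ ENNReal.ofReal_ne_top]
    congr 1
    ext z
    rw [← ENNReal.ofReal_mul (by positivity), ← ENNReal.ofReal_mul (by positivity)]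
    congr 1
    simp only [Φ, Finset.sum_add_distrib, neg_add, Real.exp_add]
    change _ * (_ * Real.exp (-∑ i, ‖∑ j, C i j * v z j‖ ^ 2)) = _
    ring
  simp_rw [h1]
  rw [lintegral_lintegral_swap (by
    apply Measurable.aemeasurable
    exact (ENNReal.continuous_ofReal.comp hΦ).measurable)]
  have h2 : ∀ z, ∫⁻ C, ENNReal.ofReal (Φ C z) = ENNReal.ofReal ((Real.pi ^ n) ^ d *
      (d.factorial * (kushCov (kushW p (fun l => (z l).re)) p).det)) := by
    intro z
    rw [← hv z]
    exact (kush_g5 (v z) p).2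
  simp_rw [h2]
  rw [kush_strip_int d (fun x => ENNReal.ofReal ((Real.pi ^ n) ^ d *
      (d.factorial * (kushCov (kushW p x) p).det))) (by
        apply Continuous.measurable
        apply ENNReal.continuous_ofReal.comp
        have := kush_cov_cont p
        fun_prop)]
  rw [← kush_vol p]
  have hd : (d.factorial : ℝ≥0∞) = ENNReal.ofReal (d.factorial : ℝ) := by simp
  rw [hd, ← lintegral_const_mul' _ _ ENNReal.ofReal_ne_top,
    ← lintegral_const_mul' _ _ ENNReal.ofReal_ne_top, ← ENNReal.ofReal_mul (by positivity),
    ← lintegral_const_mul' _ _ ENNReal.ofReal_ne_top]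
  congr 1
  ext x
  rw [← ENNReal.ofReal_mul (by positivity), ← ENNReal.ofReal_mul (by positivity),
    ← ENNReal.ofReal_mul (by positivity)]
  congr 1
  rw [mul_pow]
  ring

lemma kush_gauss_pi {E : Type} [MeasureSpace E] [SigmaFinite (volume : Measure E)]
    (f : E → ℝ) (hf : Integrable f) (h0 : ∀ x, 0 ≤ f x) (d : ℕ) :
    Integrable (fun c : Fin d → E => ∏ i, f (c i)) ∧
    ∫ c : Fin d → E, ∏ i, f (c i) = (∫ x, f x) ^ d ∧
    ∫⁻ c : Fin d → E, ENNReal.ofReal (∏ i, f (c i)) = ENNReal.ofReal ((∫ x, f x) ^ d) := by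
  have hI : Integrable (fun c : Fin d → E => ∏ i, f (c i)) := Integrable.fintype_prod fun _ => hf
  have hE : ∫ c : Fin d → E, ∏ i, f (c i) = (∫ x, f x) ^ d := by
    rw [integral_fintype_prod_volume_eq_prod]; simp
  refine ⟨hI, hE, ?_⟩
  rw [← hE, ofReal_integral_eq_lintegral_ofReal hI
    (Filter.Eventually.of_forall fun c => Finset.prod_nonneg fun i _ => h0 _)]

lemma kush_mass (d n : ℕ) :
    ∫⁻ C : Fin d → Fin n → ℂ, ENNReal.ofReal (Real.exp (-∑ i, ∑ j, ‖C i j‖ ^ 2)) =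
      ENNReal.ofReal ((Real.pi ^ n) ^ d) ∧
    ∫⁻ c : Fin d → ℂ, ENNReal.ofReal (Real.exp (-∑ i, ‖c i‖ ^ 2)) =
      ENNReal.ofReal (Real.pi ^ d) := by
  let g : ℂ → ℝ := fun z => Real.exp (-‖z‖ ^ 2)
  have hgI : Integrable g := by
    have := kush_g1.1.re
    exact this
  have hgE : ∫ z, g z = Real.pi := by
    have := kush_g1.2.2.2.2.1
    rw [integral_complex_ofReal] at this
    exact_mod_cast this
  have hg0 : ∀ z, 0 ≤ g z := fun z => (Real.exp_pos _).le
  have hprod : ∀ (m : ℕ) (c : Fin m → ℂ), Real.exp (-∑ i, ‖c i‖ ^ 2) = ∏ i, g (c i) := by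
    intro m c
    rw [← Finset.sum_neg_distrib, Real.exp_sum]
  obtain ⟨i1, e1, -⟩ := kush_gauss_pi g hgI hg0 n
  constructor
  · have h := (kush_gauss_pi (fun c : Fin n → ℂ => ∏ i, g (c i)) i1
      (fun c => Finset.prod_nonneg fun i _ => hg0 _) d).2.2
    rw [e1, hgE] at h
    rw [← h]
    congr 1
    ext C
    rw [← Finset.sum_neg_distrib, Real.exp_sum]
    simp_rw [hprod]
  · have h := (kush_gauss_pi g hgI hg0 d).2.2
    rw [hgE] at h
    rw [← h]
    simp_rw [hprod]

lemma kush_generic_ae {d n : ℕ} (q : MvPolynomial (Fin d × Fin (n + 1)) ℂ) (hq : q ≠ 0)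
    (P : (Fin d × Fin (n + 1) → ℂ) → Prop) (h : ∀ c, MvPolynomial.eval c q ≠ 0 → P c) :
    ∀ᵐ C : Fin d → Fin n → ℂ, ∀ᵐ c0 : Fin d → ℂ, P (kushL d n (C, c0)) := by
  have : (volume : Measure (Fin d → Fin n → ℂ)).IsAddHaarMeasure := Measure.pi.isAddHaarMeasure _
  have hprod : ((volume : Measure (Fin d → Fin n → ℂ)).prod
      (volume : Measure (Fin d → ℂ))).IsAddHaarMeasure := Measure.prod.instIsAddHaarMeasure _ _
  have h1 := kush_null (V := (Fin d → Fin n → ℂ) × (Fin d → ℂ))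
    ((volume : Measure (Fin d → Fin n → ℂ)).prod (volume : Measure (Fin d → ℂ))) (kushL d n) q hq
  have h2 : ∀ᵐ x ∂((volume : Measure (Fin d → Fin n → ℂ)).prod (volume : Measure (Fin d → ℂ))),
      P (kushL d n x) := by
    rw [ae_iff]
    refine measure_mono_null ?_ h1
    intro x hx
    by_contra hcon
    exact hx (h _ hcon)
  exact Measure.ae_ae_of_ae_prod h2

lemma kush_const (d n : ℕ) (a : ℝ≥0∞) :
    ∫⁻ C : Fin d → Fin n → ℂ, ENNReal.ofReal (Real.exp (-∑ i, ∑ j, ‖C i j‖ ^ 2)) *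
      ∫⁻ c0 : Fin d → ℂ, a * ENNReal.ofReal (Real.exp (-∑ i, ‖c0 i‖ ^ 2)) =
    ENNReal.ofReal ((Real.pi ^ n) ^ d) * ENNReal.ofReal (Real.pi ^ d) * a := by
  obtain ⟨m1, m2⟩ := kush_mass d n
  rw [lintegral_const_mul _ (by fun_prop), m2, lintegral_mul_const _ (by fun_prop), m1]
  ring

theorem stmt14 {d n : ℕ} (p0 : Fin n → Fin d → ℤ) :
    ∃ p : MvPolynomial (Fin d × Fin (n + 1)) ℂ, p ≠ 0 ∧
      ∀ c : Fin d → Fin (n + 1) → ℂ,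
        MvPolynomial.eval (fun ij => c ij.1 ij.2) p ≠ 0 →
        let S : Set (Fin d → ℂ) := {t | (∀ i, t i ≠ 0) ∧
          ∀ i, ∑ j : Fin n, c i j.succ * ∏ l, t l ^ p0 j l = c i 0}
        S.Finite ∧
        (S.ncard : ℝ≥0∞) = (d.factorial : ℝ≥0∞) *
          volume (convexHull ℝ
            ((Set.range fun j => fun l => (p0 j l : ℝ)) ∪ {0})) := by
  classical
  set B : ℝ≥0∞ := (d.factorial : ℝ≥0∞) *
          volume (convexHull ℝ
            ((Set.range fun j => fun l => (p0 j l : ℝ)) ∪ {0})) with hB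
  set m : ℝ≥0∞ := ENNReal.ofReal ((Real.pi ^ n) ^ d) * ENNReal.ofReal (Real.pi ^ d) with hm
  have hm0 : m ≠ 0 := by
    rw [hm]
    refine mul_ne_zero ?_ ?_ <;> exact (ENNReal.ofReal_pos.mpr (by positivity)).ne'
  have hmt : m ≠ ⊤ := ENNReal.mul_ne_top ENNReal.ofReal_ne_top ENNReal.ofReal_ne_top
  have hBt : B ≠ ⊤ := by
    apply ENNReal.mul_ne_top (by simp)
    have hfin : ((Set.range fun j => fun l => (p0 j l : ℝ)) ∪ {0}).Finite :=
      (Set.finite_range _).union (Set.finite_singleton _)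
    exact (hfin.isCompact_convexHull (𝕜 := ℝ)).measure_lt_top.ne
  have htot : _ = m * B := kush_total p0
  -- lower bound
  have hlow : ∀ k : ℕ, (∃ q : MvPolynomial (Fin d × Fin (n + 1)) ℂ, q ≠ 0 ∧
      ∀ c, MvPolynomial.eval c q ≠ 0 → (k : ℕ∞) ≤ (kushS p0 c).encard) → (k : ℝ≥0∞) ≤ B := by
    rintro k ⟨q, hq, h⟩
    have hae := kush_generic_ae q hq _ h
    have : m * k ≤ m * B := by
      rw [← htot, hm, ← kush_const d n k]
      apply lintegral_mono_ae
      filter_upwards [hae] with C hC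
      refine mul_le_mul' le_rfl ?_
      apply lintegral_mono_ae
      filter_upwards [hC] with c0 hc0
      gcongr
      exact_mod_cast hc0
    exact (ENNReal.mul_le_mul_iff_right hm0 hmt).mp this
  let Q : ℕ → Prop := fun k => ¬ (∃ q : MvPolynomial (Fin d × Fin (n + 1)) ℂ, q ≠ 0 ∧
      ∀ c, MvPolynomial.eval c q ≠ 0 → (k : ℕ∞) ≤ (kushS p0 c).encard)
  have hex : ∃ k, Q k := by
    obtain ⟨k, hk⟩ := ENNReal.exists_nat_gt hBt
    exact ⟨k, fun h => absurd (hlow k h) (not_le.mpr hk)⟩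
  have hQ0 : ¬ Q 0 := by
    intro h
    exact h ⟨1, one_ne_zero, fun c _ => by simp⟩
  obtain ⟨K, hK⟩ : ∃ K, Nat.find hex = K + 1 :=
    Nat.exists_eq_succ_of_ne_zero fun h0 => hQ0 (h0 ▸ Nat.find_spec hex)
  have hQK : Q (K + 1) := hK ▸ Nat.find_spec hex
  have hK' : ¬ Q K := Nat.find_min hex (by omega)
  obtain ⟨q1, hq1, h1⟩ := not_not.mp hK'
  obtain ⟨q2, hq2, h2⟩ := (kush_dich_count p0 (K + 1)).resolve_left hQK
  have hN : ∀ c, MvPolynomial.eval c (q1 * q2) ≠ 0 → (kushS p0 c).encard = K := by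
    intro c hc
    rw [map_mul] at hc
    have a1 := h1 c (left_ne_zero_of_mul hc)
    have a2 := h2 c (right_ne_zero_of_mul hc)
    apply le_antisymm _ a1
    push_cast at a2
    exact Order.le_of_lt_add_one (not_le.mp a2)
  have hq : q1 * q2 ≠ 0 := mul_ne_zero hq1 hq2
  have hKB : (K : ℝ≥0∞) = B := by
    have hae := kush_generic_ae _ hq _ hN
    have : m * K = m * B := by
      rw [← htot, hm, ← kush_const d n K]
      apply lintegral_congr_ae
      filter_upwards [hae] with C hC
      congr 1
      apply lintegral_congr_ae
      filter_upwards [hC] with c0 hc0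
      rw [hc0]
      simp
    exact (ENNReal.mul_right_inj hm0 hmt).mp this
  refine ⟨q1 * q2, hq, fun c hc => ?_⟩
  have hc' := hN _ hc
  intro S
  have hS : S.encard = K := hc'
  have hfin : S.Finite := Set.finite_of_encard_eq_coe hS
  refine ⟨hfin, ?_⟩
  rw [← hKB]
  have : S.ncard = K := by
    have := hfin.cast_ncard_eq
    rw [hS] at this
    exact_mod_cast this
  rw [this]
end
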